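/- arXiv:2509.05286 — 11 statements merged into one kernel-verified Lean document; each statement's English description precedes it below -/
import Mathlib

section
/- Let W : ℝ → [0,∞) be measurable and locally integrable with M := sup_{z ∈ ℤ} ∫_z^{z+1} W(p) dp < ∞, and let β ≥ 0. Then for every s > 1/2 one has lim_{λ → ∞} J^s(λ) = 0, where J^s(λ) := sup_{p ∈ ℝ} β² ∫_ℝ W(q) / (λ + |p+q|²/2)^s dq; that is, for every ε > 0 there exists λ₀ > 0 such that J^s(λ) ≤ ε for all λ ≥ λ₀. -/
open MeasureTheory ENNReal

lemma aux_pt (t : ℝ) (ht : 0 < t) (x : ℝ) (n : ℤ) (h1 : (n : ℝ) ≤ x) (h2 : x ≤ n + 2) :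
    1 / (1 + |x| ^ 2 / 2) ^ t ≤ 8 ^ t * (1 / |(n : ℝ) + 1 / 2| ^ (2 * t)) := by
  have hn : 0 < |(n : ℝ) + 1 / 2| := by
    rw [abs_pos]
    intro h
    have h3 : ((2 * n + 1 : ℤ) : ℝ) = 0 := by push_cast; linarith
    have h4 : (2 * n + 1 : ℤ) = 0 := by exact_mod_cast h3
    omega
  have hsq : |(n : ℝ) + 1 / 2| ^ (2 : ℝ) ≤ 8 * (1 + |x| ^ 2 / 2) := by
    rw [Real.rpow_two, sq_abs, sq_abs]
    nlinarith [sq_nonneg (x + 2), sq_nonneg (x - 2), sq_nonneg (2 * (n:ℝ) + 1 - 2 * x)]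
  have hx : 0 < 1 + |x| ^ 2 / 2 := by positivity
  have h : |(n : ℝ) + 1 / 2| ^ (2 * t) ≤ 8 ^ t * (1 + |x| ^ 2 / 2) ^ t := by
    rw [Real.rpow_mul hn.le, ← Real.mul_rpow (by norm_num) hx.le]
    exact Real.rpow_le_rpow (by positivity) hsq ht.le
  have hp : 0 < |(n : ℝ) + 1 / 2| ^ (2 * t) := by positivity
  rw [mul_one_div, div_le_div_iff₀ (by positivity) hp]
  linarith

lemma aux_bound (W : ℝ → ℝ) (hW0 : ∀ p, 0 ≤ W p) (M : ℝ)
    (hM : ∀ z : ℤ, ∫⁻ p in Set.Ioc (z : ℝ) (z + 1), ENNReal.ofReal (W p) ≤ ENNReal.ofReal M)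
    (t : ℝ) (ht : 0 < t) (p : ℝ) :
    ∫⁻ q, ENNReal.ofReal (W q * (1 / (1 + |p + q| ^ 2 / 2) ^ t)) ≤
      (∑' n : ℤ, ENNReal.ofReal (8 ^ t * (1 / |(n : ℝ) + 1 / 2| ^ (2 * t)))) *
        ENNReal.ofReal M := by
  rw [← ENNReal.tsum_mul_right, ← (Equiv.addLeft ⌊p⌋).tsum_eq, ← setLIntegral_univ,
    ← iUnion_Ioc_intCast ℝ, lintegral_iUnion (fun _ => measurableSet_Ioc)
      (Set.pairwise_disjoint_Ioc_intCast ℝ)]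
  refine ENNReal.tsum_le_tsum fun z => ?_
  refine le_trans ?_ (mul_le_mul_right (hM z) _)
  rw [← lintegral_const_mul' _ _ ENNReal.ofReal_ne_top]
  refine setLIntegral_mono' measurableSet_Ioc fun q hq => ?_
  rw [mul_comm, ENNReal.ofReal_mul (by positivity)]
  refine mul_le_mul_left (ENNReal.ofReal_le_ofReal ?_) _
  have a1 := Int.floor_le p
  have a2 := Int.lt_floor_add_one p
  have a3 := hq.1
  have a4 := hq.2
  apply aux_pt t ht
  · simp only [Equiv.coe_addLeft]; push_cast; linarith
  · simp only [Equiv.coe_addLeft]; push_cast; linarith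

/-- Inner integral bound (Proposition 3.2, vanishing part): under the uniform local
integrability assumption on `W`, `J^s(λ) → 0` as `λ → ∞` for every `s > 1/2`. -/
theorem stmt_1 (W : ℝ → ℝ) (hW : Measurable W) (hW0 : ∀ p, 0 ≤ W p)
    (hloc : LocallyIntegrable W volume)
    (M : ℝ)
    (hM : ∀ z : ℤ, ∫⁻ p in Set.Ioc (z : ℝ) (z + 1), ENNReal.ofReal (W p) ≤ ENNReal.ofReal M)
    (β : ℝ) (hβ : 0 ≤ β) (s : ℝ) (hs : 1 / 2 < s) :
    ∀ ε : ℝ, 0 < ε → ∃ lam₀ : ℝ, 0 < lam₀ ∧ ∀ lam : ℝ, lam₀ ≤ lam →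
      (⨆ p : ℝ, ∫⁻ q, ENNReal.ofReal (β ^ 2 * W q / (lam + |p + q| ^ 2 / 2) ^ s))
        ≤ ENNReal.ofReal ε := by
  intro ε hε
  obtain ⟨t, ht1, ht2⟩ := exists_between hs
  have ht : 0 < t := by linarith
  have hK : (∑' n : ℤ, ENNReal.ofReal (8 ^ t * (1 / |(n : ℝ) + 1 / 2| ^ (2 * t)))) *
        ENNReal.ofReal M ≠ ∞ := by
    refine ENNReal.mul_ne_top ?_ ENNReal.ofReal_ne_top
    have hsum : Summable fun n : ℤ => (8:ℝ) ^ t * (1 / |(n : ℝ) + 1 / 2| ^ (2 * t)) :=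
      ((Real.summable_one_div_int_add_rpow (1 / 2) (2 * t)).2 (by linarith)).mul_left _
    exact hsum.tsum_ofReal_ne_top
  have hB := aux_bound W hW0 M hM t ht
  obtain ⟨K, hKe⟩ : ∃ K, K = (∑' n : ℤ, ENNReal.ofReal (8 ^ t * (1 / |(n : ℝ) + 1 / 2| ^ (2 * t)))) *
        ENNReal.ofReal M := ⟨_, rfl⟩
  rw [← hKe] at hK
  simp only [← hKe] at hB
  have hlim : Filter.Tendsto (fun lam : ℝ => β ^ 2 * K.toReal * lam ^ (-(s - t)))
      Filter.atTop (nhds 0) := by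
    simpa using (tendsto_rpow_neg_atTop (sub_pos.2 ht2)).const_mul (β ^ 2 * K.toReal)
  obtain ⟨L, hL⟩ := Filter.eventually_atTop.1 (hlim.eventually (ge_mem_nhds hε))
  refine ⟨max L 1, by positivity, fun lam hlam => iSup_le fun p => ?_⟩
  have hl1 : 1 ≤ lam := le_trans (le_max_right _ _) hlam
  have hl0 : 0 < lam := by linarith
  have hfin := hL lam (le_trans (le_max_left _ _) hlam)
  calc ∫⁻ q, ENNReal.ofReal (β ^ 2 * W q / (lam + |p + q| ^ 2 / 2) ^ s)
      ≤ ∫⁻ q, ENNReal.ofReal (β ^ 2 * lam ^ (-(s - t))) *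
          ENNReal.ofReal (W q * (1 / (1 + |p + q| ^ 2 / 2) ^ t)) := by
        refine lintegral_mono fun q => ?_
        rw [← ENNReal.ofReal_mul (by positivity)]
        refine ENNReal.ofReal_le_ofReal ?_
        have hy : 0 ≤ |p + q| ^ 2 / 2 := by positivity
        generalize |p + q| ^ 2 / 2 = y at hy
        have e1 : lam ^ (s - t) * (1 + y) ^ t ≤ (lam + y) ^ s := by
          have : (lam + y) ^ s = (lam + y) ^ (s - t) * (lam + y) ^ t := by
            rw [← Real.rpow_add (by linarith)]; congr 1; ring
          rw [this]
          exact mul_le_mul (Real.rpow_le_rpow hl0.le (by linarith) (by linarith))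
            (Real.rpow_le_rpow (by linarith) (by linarith) ht.le) (by positivity) (by positivity)
        have e2 : β ^ 2 * lam ^ (-(s - t)) * (W q * (1 / (1 + y) ^ t)) =
            β ^ 2 * W q / (lam ^ (s - t) * (1 + y) ^ t) := by
          rw [Real.rpow_neg hl0.le]
          field_simp
        rw [e2]
        exact div_le_div_of_nonneg_left (mul_nonneg (sq_nonneg _) (hW0 q)) (by positivity) e1
    _ ≤ ENNReal.ofReal (β ^ 2 * lam ^ (-(s - t))) * K := by
        rw [lintegral_const_mul' _ _ ENNReal.ofReal_ne_top]
        exact mul_le_mul_right (hB p) _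
    _ ≤ ENNReal.ofReal ε := by
        rw [← ENNReal.ofReal_toReal hK, ← ENNReal.ofReal_mul (by positivity)]
        refine ENNReal.ofReal_le_ofReal (le_trans (le_of_eq ?_) hfin)
        ring
end

section
/- For every s > 1/2 there exists a constant C = C(s) > 0 such that for every measurable W : ℝ → [0,∞) with M := sup_{z ∈ ℤ} ∫_z^{z+1} W(p) dp < ∞, every p ∈ ℝ, every λ > 0 and every R ≥ 1, one has ∫_ℝ W(q) / (λ + |p+q|²/2)^s dq ≤ C · M · (R · λ^{-s} + R^{1-2s}). -/
open MeasureTheory ENNReal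

lemma cover_bound (f : ℝ → ℝ≥0∞) (M : ℝ)
    (h : ∀ z : ℤ, ∫⁻ p in Set.Ioc (z : ℝ) (z + 1), f p ≤ ENNReal.ofReal M)
    (a R : ℝ) (hR : 1 ≤ R) :
    ∫⁻ p in Set.Icc a (a + R), f p ≤ ENNReal.ofReal (3 * R) * ENNReal.ofReal M := by
  set N : ℕ := ⌈R⌉₊ + 1 with hN
  have hN1 : R + 1 ≤ (N : ℝ) := by
    have := Nat.le_ceil R
    rw [hN]; push_cast; linarith
  have hN2 : (N : ℝ) ≤ 3 * R := by
    have := Nat.ceil_lt_add_one (show (0:ℝ) ≤ R by linarith)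
    rw [hN]; push_cast; linarith
  have hsub : Set.Icc a (a + R) ⊆
      ⋃ k ∈ Finset.range N, Set.Ioc (((⌈a⌉ - 1 + (k : ℤ) : ℤ) : ℝ)) (((⌈a⌉ - 1 + (k : ℤ) : ℤ) : ℝ) + 1) := by
    intro x hx
    have h1 : ⌈a⌉ ≤ ⌈x⌉ := Int.ceil_mono hx.1
    have ha := Int.ceil_lt_add_one a
    have ha' := Int.le_ceil a
    have hxl := Int.ceil_lt_add_one x
    have hxl' := Int.le_ceil x
    have h2 : ⌈x⌉ < ⌈a⌉ + N := by
      have : (⌈x⌉ : ℝ) < ((⌈a⌉ + N : ℤ) : ℝ) := by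
        push_cast; linarith [hx.2]
      exact_mod_cast this
    simp only [Set.mem_iUnion, Finset.mem_range]
    refine ⟨(⌈x⌉ - ⌈a⌉).toNat, by omega, ?_⟩
    have h3 : ⌈a⌉ - 1 + ((⌈x⌉ - ⌈a⌉).toNat : ℤ) = ⌈x⌉ - 1 := by omega
    rw [h3]; push_cast
    constructor <;> linarith
  calc ∫⁻ p in Set.Icc a (a + R), f p
      ≤ ∫⁻ p in ⋃ k ∈ Finset.range N, Set.Ioc (((⌈a⌉ - 1 + (k : ℤ) : ℤ) : ℝ)) (((⌈a⌉ - 1 + (k : ℤ) : ℤ) : ℝ) + 1), f p :=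
        lintegral_mono_set hsub
    _ ≤ ∑ k ∈ Finset.range N, ∫⁻ p in Set.Ioc (((⌈a⌉ - 1 + (k : ℤ) : ℤ) : ℝ)) (((⌈a⌉ - 1 + (k : ℤ) : ℤ) : ℝ) + 1), f p := by
        generalize Finset.range N = t
        induction t using Finset.induction_on with
        | empty => simp
        | insert b t hb ih =>
          rw [Finset.sum_insert hb, Finset.set_biUnion_insert]
          exact (lintegral_union_le _ _ _).trans (by gcongr)
    _ ≤ ∑ k ∈ Finset.range N, ENNReal.ofReal M := Finset.sum_le_sum fun k _ => h _
    _ = ENNReal.ofReal N * ENNReal.ofReal M := by simp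
    _ ≤ _ := by gcongr

theorem stmt_2 (s : ℝ) (hs : 1 / 2 < s) :
    ∃ C : ℝ, 0 < C ∧ ∀ (W : ℝ → ℝ), Measurable W → (∀ p, 0 ≤ W p) →
      ∀ M : ℝ,
        (∀ z : ℤ, ∫⁻ p in Set.Ioc (z : ℝ) (z + 1), ENNReal.ofReal (W p) ≤ ENNReal.ofReal M) →
      ∀ p lam R : ℝ, 0 < lam → 1 ≤ R →
        ∫⁻ q, ENNReal.ofReal (W q / (lam + |p + q| ^ 2 / 2) ^ s)
          ≤ ENNReal.ofReal (C * M * (R * lam ^ (-s) + R ^ (1 - 2 * s))) := by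
  have hsum : Summable (fun n : ℕ => (n : ℝ) ^ (-(2 * s))) :=
    Real.summable_nat_rpow.2 (by linarith)
  set T : ℝ := ∑' n : ℕ, (n : ℝ) ^ (-(2 * s)) with hT
  have hT0 : 0 ≤ T := tsum_nonneg fun n => by positivity
  refine ⟨6 * (1 + 2 ^ s * T), by positivity, ?_⟩
  intro W hW hW0 M hM p lam R hlam hR
  have hR0 : 0 < R := by linarith
  set w : ℕ → ℝ := fun n => (if n = 0 then lam ^ (-s) else 0) +
    2 ^ s * R ^ (-(2 * s)) * (n : ℝ) ^ (-(2 * s)) with hw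
  have hw0 : ∀ n, 0 ≤ w n := by
    intro n; simp only [hw]
    split_ifs <;> positivity
  have hws : HasSum w (lam ^ (-s) + 2 ^ s * R ^ (-(2 * s)) * T) :=
    (hasSum_ite_eq 0 _).add (hsum.hasSum.mul_left _)
  set A : ℕ → Set ℝ := fun n => {q | n * R ≤ |p + q| ∧ |p + q| < (n + 1) * R} with hA
  have hAm : ∀ n, MeasurableSet (A n) := by
    intro n
    have hc : Measurable fun q : ℝ => |p + q| := by fun_prop
    exact (measurableSet_le measurable_const hc).inter (measurableSet_lt hc measurable_const)
  have hAU : (⋃ n, A n) = Set.univ := by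
    refine Set.eq_univ_of_forall fun q => Set.mem_iUnion.2 ⟨⌊|p + q| / R⌋₊, ?_, ?_⟩
    · exact (le_div_iff₀ hR0).1 (Nat.floor_le (by positivity))
    · exact (div_lt_iff₀ hR0).1 (Nat.lt_floor_add_one _)
  have hAf : ∀ n, ∫⁻ q in A n, ENNReal.ofReal (W q) ≤ ENNReal.ofReal (6 * R) * ENNReal.ofReal M := by
    intro n
    have hsub : A n ⊆ Set.Icc (n * R - p) (n * R - p + R) ∪
        Set.Icc (-(n + 1) * R - p) (-(n + 1) * R - p + R) := by
      rintro q ⟨h1, h2⟩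
      rcases abs_cases (p + q) with ⟨h, _⟩ | ⟨h, _⟩ <;> rw [h] at h1 h2
      · left; constructor <;> nlinarith
      · right; constructor <;> nlinarith
    refine (lintegral_mono_set hsub).trans ((lintegral_union_le _ _ _).trans ?_)
    refine (add_le_add (cover_bound _ M hM _ R hR) (cover_bound _ M hM _ R hR)).trans ?_
    rw [← add_mul, ← ENNReal.ofReal_add (by positivity) (by positivity)]
    apply le_of_eq; congr 2; ring
  have hpt : ∀ n, ∀ q ∈ A n, W q / (lam + |p + q| ^ 2 / 2) ^ s ≤ w n * W q := by
    rintro n q ⟨h1, h2⟩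
    have hs0 : 0 < s := by linarith
    rw [div_eq_mul_inv, mul_comm, ← Real.rpow_neg (by positivity)]
    refine mul_le_mul_of_nonneg_right ?_ (hW0 q)
    by_cases hn : n = 0
    · have : (lam + |p + q| ^ 2 / 2) ^ (-s) ≤ lam ^ (-s) :=
        Real.rpow_le_rpow_of_nonpos hlam (by positivity |> fun (h : 0 ≤ |p + q| ^ 2 / 2) => by linarith) (by linarith)
      refine this.trans ?_
      simp only [hw, hn, if_true]
      have : 0 ≤ (2:ℝ) ^ s * R ^ (-(2 * s)) * ((0:ℕ) : ℝ) ^ (-(2 * s)) := by positivity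
      linarith
    · have hn' : 0 < (n : ℝ) := by positivity
      have hle : (n * R) ^ 2 / 2 ≤ lam + |p + q| ^ 2 / 2 := by
        have : (n * R) ^ 2 ≤ |p + q| ^ 2 := by gcongr
        linarith
      have := Real.rpow_le_rpow_of_nonpos (by positivity) hle (show -s ≤ 0 by linarith)
      refine this.trans (le_of_eq ?_)
      simp only [hw, hn, if_false, zero_add]
      rw [Real.div_rpow (by positivity) (by positivity), ← Real.rpow_natCast, ← Real.rpow_mul (by positivity),
        Real.mul_rpow hn'.le hR0.le, Real.rpow_neg (by norm_num : (0:ℝ) ≤ 2), div_inv_eq_mul]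
      have : ((2:ℕ):ℝ) * -s = -(2 * s) := by push_cast; ring
      rw [this]; ring
  calc ∫⁻ q, ENNReal.ofReal (W q / (lam + |p + q| ^ 2 / 2) ^ s)
      = ∫⁻ q in ⋃ n, A n, ENNReal.ofReal (W q / (lam + |p + q| ^ 2 / 2) ^ s) := by
        rw [hAU, Measure.restrict_univ]
    _ ≤ ∑' n, ∫⁻ q in A n, ENNReal.ofReal (W q / (lam + |p + q| ^ 2 / 2) ^ s) :=
        lintegral_iUnion_le _ _
    _ ≤ ∑' n, ENNReal.ofReal (w n) * (ENNReal.ofReal (6 * R) * ENNReal.ofReal M) := by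
        refine ENNReal.tsum_le_tsum fun n => ?_
        calc _ ≤ ∫⁻ q in A n, ENNReal.ofReal (w n) * ENNReal.ofReal (W q) := by
              refine setLIntegral_mono' (hAm n) fun q hq => ?_
              rw [← ENNReal.ofReal_mul (hw0 n)]
              exact ENNReal.ofReal_le_ofReal (hpt n q hq)
          _ = ENNReal.ofReal (w n) * ∫⁻ q in A n, ENNReal.ofReal (W q) :=
              lintegral_const_mul _ (by fun_prop)
          _ ≤ _ := by gcongr; exact hAf n
    _ = ENNReal.ofReal (lam ^ (-s) + 2 ^ s * R ^ (-(2 * s)) * T) *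
          (ENNReal.ofReal (6 * R) * ENNReal.ofReal M) := by
        rw [ENNReal.tsum_mul_right, ← ENNReal.ofReal_tsum_of_nonneg hw0 hws.summable, hws.tsum_eq]
    _ = ENNReal.ofReal ((lam ^ (-s) + 2 ^ s * R ^ (-(2 * s)) * T) * (6 * R)) * ENNReal.ofReal M := by
        rw [← mul_assoc, ← ENNReal.ofReal_mul (by positivity)]
    _ ≤ ENNReal.ofReal (6 * (1 + 2 ^ s * T) * (R * lam ^ (-s) + R ^ (1 - 2 * s))) * ENNReal.ofReal M := by
        gcongr ENNReal.ofReal ?_ * _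
        have hRR : R ^ (1 - 2 * s) = R * R ^ (-(2 * s)) := by
          rw [sub_eq_add_neg, Real.rpow_add hR0, Real.rpow_one]
        rw [hRR]
        have h1 : 0 ≤ R * R ^ (-(2 * s)) := by positivity
        have h2 : 0 ≤ (2 ^ s * T) * (R * lam ^ (-s)) := by positivity
        nlinarith
    _ = _ := by
        rw [← ENNReal.ofReal_mul (by positivity)]
        congr 1; ring
end

section
/- Let W : ℝ → [0,∞) be measurable and locally integrable, and suppose there exists a sequence (z_n) of integers such that ∫_{z_n}^{z_n+1} W(q) dq → ∞ as n → ∞. Then for every λ > 0 and every s > 0 one has sup_{p ∈ ℝ} ∫_ℝ W(q) / (λ + |p+q|²/2)^s dq = ∞. -/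
open MeasureTheory ENNReal

/-- Remark 3.3: if the uniform local integrability condition fails along a sequence of
integers `z_n` (the masses `∫_{z_n}^{z_n+1} W → ∞`), then the inner integral quantity
`sup_p ∫ W(q)/(λ + |p+q|²/2)^s dq` is infinite for every `λ > 0`, `s > 0`. -/
theorem stmt_3 (W : ℝ → ℝ) (hW : Measurable W) (hW0 : ∀ p, 0 ≤ W p)
    (hloc : LocallyIntegrable W volume)
    (z : ℕ → ℤ)
    (hz : Filter.Tendsto
            (fun n => ∫⁻ q in Set.Ioc ((z n : ℝ)) ((z n : ℝ) + 1), ENNReal.ofReal (W q))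
            Filter.atTop (nhds ⊤))
    (lam s : ℝ) (hlam : 0 < lam) (hs : 0 < s) :
    (⨆ p : ℝ, ∫⁻ q, ENNReal.ofReal (W q / (lam + |p + q| ^ 2 / 2) ^ s)) = ⊤ := by
  have hc : 0 < (lam + 1 / 2) ^ s := Real.rpow_pos_of_pos (by linarith) s
  have hT := ENNReal.Tendsto.const_mul (a := ENNReal.ofReal (((lam + 1 / 2) ^ s)⁻¹)) hz
    (Or.inl ENNReal.top_ne_zero)
  rw [ENNReal.mul_top (by simpa using hc)] at hT
  refine top_le_iff.mp (le_of_tendsto' hT fun n => ?_)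
  refine le_trans ?_ (le_iSup _ (-(z n : ℝ)))
  rw [← lintegral_const_mul _ hW.ennreal_ofReal]
  refine le_trans (setLIntegral_mono' measurableSet_Ioc fun q hq => ?_)
    (setLIntegral_le_lintegral (Set.Ioc (z n : ℝ) ((z n : ℝ) + 1)) _)
  rw [← ENNReal.ofReal_mul (inv_nonneg.mpr hc.le)]
  apply ENNReal.ofReal_le_ofReal
  rw [mul_comm, ← div_eq_mul_inv]
  have h0 : 0 < lam + |(-(z n : ℝ)) + q| ^ 2 / 2 := by positivity
  apply div_le_div_of_nonneg_left (hW0 q) (Real.rpow_pos_of_pos h0 s)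
  apply Real.rpow_le_rpow h0.le _ hs.le
  rw [sq_abs]
  nlinarith [hq.1, hq.2]
end

section
/- Let W : ℝ → [0,∞) be measurable and set K := sup_{a ∈ ℝ} ∫_ℝ W(q) / (1 + |a+q|²/2) dq ∈ [0,∞]. Then for every n ≥ 1 and every measurable ψ : ℝⁿ → ℂ, the following inequality holds in [0,∞]: ∫_{ℝ^{n+1}} ( |∑_{i=1}^n p_i|² · |ψ(p₁,…,p_n)|² / (1 + |∑_{i=1}^{n+1} p_i|²/2) ) · ∏_{i=1}^{n+1} W(p_i) dp₁…dp_{n+1} ≤ K · ∫_{ℝⁿ} |∑_{i=1}^n p_i|² · |ψ(p₁,…,p_n)|² · ∏_{i=1}^n W(p_i) dp₁…dp_n. -/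
open MeasureTheory ENNReal

/-- Core estimate in the proof of the Graded Sector Condition (Lemma 3.4): the free
`(n+1)`-st variable is integrated on the inside and controlled by the inner integral
quantity `K = sup_a ∫ W(q)/(1 + |a+q|²/2) dq`. -/
theorem stmt_4 (n : ℕ) (hn : 1 ≤ n) (W : ℝ → ℝ) (hW : Measurable W) (hW0 : ∀ p, 0 ≤ W p)
    (ψ : (Fin n → ℝ) → ℂ) (hψ : Measurable ψ) :
    ∫⁻ p : Fin (n + 1) → ℝ,
        ENNReal.ofReal
            ((∑ i : Fin n, p i.castSucc) ^ 2 * ‖ψ (fun i => p i.castSucc)‖ ^ 2 /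
              (1 + (∑ i, p i) ^ 2 / 2)) *
          ∏ i, ENNReal.ofReal (W (p i))
      ≤ (⨆ a : ℝ, ∫⁻ q, ENNReal.ofReal (W q / (1 + (a + q) ^ 2 / 2))) *
          ∫⁻ p : Fin n → ℝ,
            ENNReal.ofReal ((∑ i, p i) ^ 2 * ‖ψ p‖ ^ 2) * ∏ i, ENNReal.ofReal (W (p i)) := by
  have hmp := volume_preserving_piFinSuccAbove (fun _ : Fin (n + 1) => ℝ) (Fin.last n)
  let F : (Fin n → ℝ) → ℝ≥0∞ := fun p =>
    ENNReal.ofReal ((∑ i, p i) ^ 2 * ‖ψ p‖ ^ 2) * ∏ i, ENNReal.ofReal (W (p i))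
  let H : ℝ × (Fin n → ℝ) → ℝ≥0∞ := fun z =>
    ENNReal.ofReal (W z.1 / (1 + ((∑ i, z.2 i) + z.1) ^ 2 / 2))
  have hF : Measurable F := by
    refine Measurable.mul (by fun_prop) ?_
    exact Finset.measurable_prod _ fun i _ => by fun_prop
  have hH : Measurable H := by
    have : Measurable fun z : ℝ × (Fin n → ℝ) => W z.1 := hW.comp measurable_fst
    have h2 : Measurable fun z : ℝ × (Fin n → ℝ) => (1 + ((∑ i, z.2 i) + z.1) ^ 2 / 2) := by
      fun_prop
    exact (this.div h2).ennreal_ofReal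
  have hG : Measurable fun z : ℝ × (Fin n → ℝ) => F z.2 * H z :=
    (hF.comp measurable_snd).mul hH
  have key : ∀ p : Fin (n + 1) → ℝ,
      ENNReal.ofReal
            ((∑ i : Fin n, p i.castSucc) ^ 2 * ‖ψ (fun i => p i.castSucc)‖ ^ 2 /
              (1 + (∑ i, p i) ^ 2 / 2)) *
          ∏ i, ENNReal.ofReal (W (p i)) =
      (fun z : ℝ × (Fin n → ℝ) => F z.2 * H z)
        (MeasurableEquiv.piFinSuccAbove (fun _ : Fin (n + 1) => ℝ) (Fin.last n) p) := by
    intro p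
    have he : MeasurableEquiv.piFinSuccAbove (fun _ : Fin (n + 1) => ℝ) (Fin.last n) p
        = (p (Fin.last n), fun i => p i.castSucc) := by
      refine Prod.ext rfl ?_
      funext i
      change p ((Fin.last n).succAbove i) = _
      rw [Fin.succAbove_last]
    rw [he]
    simp only [F, H]
    rw [Fin.prod_univ_castSucc, Fin.sum_univ_castSucc, div_eq_mul_inv, div_eq_mul_inv (W _),
      ENNReal.ofReal_mul (by positivity), ENNReal.ofReal_mul (hW0 _)]
    ring
  rw [lintegral_congr key, hmp.lintegral_comp hG]
  rw [Measure.volume_eq_prod, lintegral_prod_symm _ hG.aemeasurable]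
  calc _ ≤ ∫⁻ p : Fin n → ℝ, (⨆ a : ℝ, ∫⁻ q, ENNReal.ofReal (W q / (1 + (a + q) ^ 2 / 2))) * F p := by
        refine lintegral_mono fun p => ?_
        dsimp only
        have hp : Measurable fun x : ℝ => H (x, p) := hH.comp measurable_prodMk_right
        rw [lintegral_const_mul _ hp, mul_comm]
        gcongr
        exact le_iSup (fun a : ℝ => ∫⁻ q, ENNReal.ofReal (W q / (1 + (a + q) ^ 2 / 2))) (∑ i, p i)
    _ = _ := lintegral_const_mul _ hF
end

section
/- Let W : ℝ → [0,∞) be measurable, K := sup_{a ∈ ℝ} ∫_ℝ W(q)/(1 + |a+q|²/2) dq < ∞, β ≥ 0, and n ≥ 1. Let ψ : ℝⁿ → ℂ be measurable and symmetric (invariant under permutations of its arguments). Define A₊ψ : ℝ^{n+1} → ℂ by A₊ψ(p₁,…,p_{n+1}) = (iβ/(n+1)) · ∑_{i=1}^{n+1} ( ∑_{k ≠ i} p_k ) · ψ(p₁,…,p̂ᵢ,…,p_{n+1}) (the hat denoting omission of the i-th variable). Then, in [0,∞], (n+1)! ∫_{ℝ^{n+1}} ∏_{i=1}^{n+1} W(p_i)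 · |A₊ψ(p)|² / (1 + |∑_{i=1}^{n+1} p_i|²/2) dp ≤ 2 β² K (n+1) · n! ∫_{ℝⁿ} ∏_{i=1}^{n} W(p_i) · (1 + |∑_{i=1}^{n} p_i|²/2) · |ψ(p)|² dp. -/
open MeasureTheory ENNReal

lemma aux_pt_s5 {n : ℕ} (β : ℝ) (a : Fin (n+1) → ℂ) :
    ‖(Complex.I * (β : ℂ) / ((n : ℂ) + 1)) * ∑ i, a i‖ ^ 2 ≤
      ∑ i, β ^ 2 / ((n : ℝ) + 1) * ‖a i‖ ^ 2 := by
  have h1 : ‖(Complex.I * (β : ℂ) / ((n : ℂ) + 1))‖ ^ 2 = β ^ 2 / ((n : ℝ) + 1) ^ 2 := by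
    have : ‖((n : ℂ) + 1)‖ = (n : ℝ) + 1 := by
      have := Complex.norm_natCast (n + 1)
      push_cast at this
      exact this
    rw [norm_div, this, norm_mul]
    simp [div_pow]
  have h2 : ‖∑ i, a i‖ ^ 2 ≤ ((n : ℝ) + 1) * ∑ i, ‖a i‖ ^ 2 := by
    calc ‖∑ i, a i‖ ^ 2 ≤ (∑ i, ‖a i‖) ^ 2 := by
          gcongr
          exact norm_sum_le _ _
      _ ≤ _ := by
          have := sq_sum_le_card_mul_sum_sq (s := Finset.univ) (f := fun i => ‖a i‖)
          simpa using this
  rw [norm_mul, mul_pow, h1, ← Finset.mul_sum]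
  have hn : (0 : ℝ) < n + 1 := by positivity
  calc _ ≤ β ^ 2 / ((n : ℝ) + 1) ^ 2 * (((n : ℝ) + 1) * ∑ i, ‖a i‖ ^ 2) := by gcongr
    _ = _ := by field_simp

lemma aux_int (W : ℝ → ℝ) (hW : Measurable W) (hW0 : ∀ p, 0 ≤ W p)
    (K : ℝ≥0∞) (hK : K = ⨆ a : ℝ, ∫⁻ q, ENNReal.ofReal (W q / (1 + (a + q) ^ 2 / 2)))
    (n : ℕ) (ψ : (Fin n → ℝ) → ℂ) (hψ : Measurable ψ) (i : Fin (n + 1)) :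
    ∫⁻ p : Fin (n + 1) → ℝ, (∏ j, ENNReal.ofReal (W (p j))) *
        ENNReal.ofReal ((∑ k, p (i.succAbove k)) ^ 2 * ‖ψ (fun k => p (i.succAbove k))‖ ^ 2
          / (1 + (∑ j, p j) ^ 2 / 2)) ≤
      K * (2 * ∫⁻ p : Fin n → ℝ, (∏ i, ENNReal.ofReal (W (p i))) *
              ENNReal.ofReal ((1 + (∑ i, p i) ^ 2 / 2) * ‖ψ p‖ ^ 2)) := by
  set G : (Fin n → ℝ) → ℝ≥0∞ := fun q => (∏ j, ENNReal.ofReal (W (q j))) *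
      ENNReal.ofReal ((∑ k, q k) ^ 2 * ‖ψ q‖ ^ 2) with hG
  have hGm : Measurable G := by fun_prop
  set F : ℝ × (Fin n → ℝ) → ℝ≥0∞ := fun z =>
    ENNReal.ofReal (W z.1 / (1 + ((∑ k, z.2 k) + z.1) ^ 2 / 2)) * G z.2 with hF
  have hFm : Measurable F := by fun_prop
  have e : ∀ p : Fin (n + 1) → ℝ, (∏ j, ENNReal.ofReal (W (p j))) *
        ENNReal.ofReal ((∑ k, p (i.succAbove k)) ^ 2 * ‖ψ (fun k => p (i.succAbove k))‖ ^ 2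
          / (1 + (∑ j, p j) ^ 2 / 2)) =
        F (MeasurableEquiv.piFinSuccAbove (fun _ => ℝ) i p) := by
    intro p
    have : MeasurableEquiv.piFinSuccAbove (fun _ => ℝ) i p
      = (p i, fun k => p (i.succAbove k)) := rfl
    rw [this, Fin.prod_univ_succAbove _ i, Fin.sum_univ_succAbove _ i]
    simp only [hF, hG]
    rw [add_comm (p i), div_eq_mul_inv _ (1 + (_ : ℝ) ^ 2 / 2),
      div_eq_mul_inv (W (p i)), ENNReal.ofReal_mul (by positivity),
      ENNReal.ofReal_mul (hW0 _)]
    ring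
  simp_rw [e]
  rw [(volume_preserving_piFinSuccAbove (fun _ : Fin (n + 1) => ℝ) i).lintegral_comp hFm]
  rw [Measure.volume_eq_prod, lintegral_prod_symm' _ hFm]
  rw [← lintegral_const_mul _ (by fun_prop), ← lintegral_const_mul _ (by fun_prop)]
  apply lintegral_mono
  intro q
  simp only [hF]
  rw [lintegral_mul_const _ (by fun_prop)]
  refine mul_le_mul' ?_ ?_
  · rw [hK]
    exact le_iSup (fun a : ℝ => ∫⁻ q, ENNReal.ofReal (W q / (1 + (a + q) ^ 2 / 2))) (∑ k, q k)
  · simp only [hG]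
    rw [mul_left_comm]
    refine mul_le_mul' le_rfl ?_
    rw [← ENNReal.ofReal_ofNat 2, ← ENNReal.ofReal_mul (by norm_num)]
    apply ENNReal.ofReal_le_ofReal
    nlinarith [sq_nonneg ‖ψ q‖]

/-- Graded Sector Condition for `A₊` at fixed chaos level `n` with weight exponent `α = 1`
(Lemma 3.4): `‖A₊ψ‖²_{H^{-1}_0} ≤ 2 β² K (n+1) ‖ψ‖²_{H^1_1}` with both Fock-space norms
written out explicitly, `K` being the inner integral quantity. -/
theorem stmt_5 (W : ℝ → ℝ) (hW : Measurable W) (hW0 : ∀ p, 0 ≤ W p)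
    (K : ℝ≥0∞) (hK : K = ⨆ a : ℝ, ∫⁻ q, ENNReal.ofReal (W q / (1 + (a + q) ^ 2 / 2)))
    (hKfin : K ≠ ⊤)
    (β : ℝ) (hβ : 0 ≤ β) (n : ℕ) (hn : 1 ≤ n)
    (ψ : (Fin n → ℝ) → ℂ) (hψ : Measurable ψ)
    (hsym : ∀ (σ : Equiv.Perm (Fin n)) (p : Fin n → ℝ), ψ (p ∘ σ) = ψ p) :
    (Nat.factorial (n + 1) : ℝ≥0∞) *
        ∫⁻ p : Fin (n + 1) → ℝ,
          (∏ i, ENNReal.ofReal (W (p i))) *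
            ENNReal.ofReal
              (‖(Complex.I * (β : ℂ) / ((n : ℂ) + 1)) *
                  ∑ i : Fin (n + 1), ((∑ k ∈ Finset.univ.erase i, p k : ℝ) : ℂ) *
                    ψ (fun k => p (i.succAbove k))‖ ^ 2 /
                (1 + (∑ i, p i) ^ 2 / 2))
      ≤ ENNReal.ofReal (2 * β ^ 2) * K * ((n : ℝ≥0∞) + 1) * (Nat.factorial n : ℝ≥0∞) *
          ∫⁻ p : Fin n → ℝ,
            (∏ i, ENNReal.ofReal (W (p i))) *
              ENNReal.ofReal ((1 + (∑ i, p i) ^ 2 / 2) * ‖ψ p‖ ^ 2) := by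
  have hpt : ∀ p : Fin (n + 1) → ℝ, (∏ i, ENNReal.ofReal (W (p i))) *
            ENNReal.ofReal
              (‖(Complex.I * (β : ℂ) / ((n : ℂ) + 1)) *
                  ∑ i : Fin (n + 1), ((∑ k ∈ Finset.univ.erase i, p k : ℝ) : ℂ) *
                    ψ (fun k => p (i.succAbove k))‖ ^ 2 /
                (1 + (∑ i, p i) ^ 2 / 2)) ≤
      ∑ i : Fin (n + 1), ENNReal.ofReal (β ^ 2 / ((n : ℝ) + 1)) *
        ((∏ j, ENNReal.ofReal (W (p j))) *
        ENNReal.ofReal ((∑ k, p (i.succAbove k)) ^ 2 * ‖ψ (fun k => p (i.succAbove k))‖ ^ 2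
          / (1 + (∑ j, p j) ^ 2 / 2))) := by
    intro p
    have hs : ∀ i : Fin (n + 1), ∑ k ∈ Finset.univ.erase i, p k = ∑ k, p (i.succAbove k) := by
      intro i
      have h1 := Finset.add_sum_erase Finset.univ p (Finset.mem_univ i)
      rw [Fin.sum_univ_succAbove _ i] at h1
      linarith
    simp_rw [mul_left_comm (ENNReal.ofReal (β ^ 2 / ((n : ℝ) + 1)))]
    rw [← Finset.mul_sum]
    refine mul_le_mul' le_rfl ?_
    simp_rw [← ENNReal.ofReal_mul (show 0 ≤ β ^ 2 / ((n : ℝ) + 1) by positivity)]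
    rw [← ENNReal.ofReal_sum_of_nonneg (fun i _ => by positivity)]
    apply ENNReal.ofReal_le_ofReal
    refine (div_le_div_of_nonneg_right (aux_pt_s5 β _) (by positivity)).trans (le_of_eq ?_)
    rw [Finset.sum_div]
    refine Finset.sum_congr rfl fun i _ => ?_
    rw [hs, norm_mul, Complex.norm_real, mul_pow, Real.norm_eq_abs, sq_abs, mul_div_assoc]
  refine (mul_le_mul' le_rfl (lintegral_mono hpt)).trans ?_
  rw [lintegral_finsetSum _ (fun i _ => by fun_prop)]
  set I := ∫⁻ p : Fin n → ℝ, (∏ i, ENNReal.ofReal (W (p i))) *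
              ENNReal.ofReal ((1 + (∑ i, p i) ^ 2 / 2) * ‖ψ p‖ ^ 2) with hI
  have hb : ∀ i ∈ (Finset.univ : Finset (Fin (n + 1))), _ ≤ ENNReal.ofReal (β ^ 2 / ((n : ℝ) + 1)) * (K * (2 * I)) :=
    fun i _ => (lintegral_const_mul _ (by fun_prop)).le.trans
      (mul_le_mul' le_rfl (aux_int W hW hW0 K hK n ψ hψ i))
  refine (mul_le_mul' le_rfl (Finset.sum_le_card_nsmul _ _ _ hb)).trans (le_of_eq ?_)
  have hc : ((n : ℝ≥0∞) + 1) * ENNReal.ofReal (β ^ 2 / ((n : ℝ) + 1)) = ENNReal.ofReal (β ^ 2) := by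
    have h : ((n : ℝ≥0∞) + 1) = ENNReal.ofReal ((n : ℝ) + 1) := by
      rw [ENNReal.ofReal_add (by positivity) (by norm_num)]
      simp
    rw [h, ← ENNReal.ofReal_mul (by positivity)]
    congr 1
    field_simp
  rw [nsmul_eq_mul, Finset.card_univ, Fintype.card_fin, Nat.factorial_succ,
    ENNReal.ofReal_mul (by norm_num : (0:ℝ) ≤ 2), ENNReal.ofReal_ofNat, ← hc]
  push_cast
  ring
end

section
/- Let W : ℝ → [0,∞) be measurable, β ≥ 0, and n ≥ 2. Let ψ : ℝⁿ → ℂ and φ : ℝ^{n-1} → ℂ be measurable and symmetric, and assume the absolute integrability ∫_{ℝⁿ} ∏_{i=1}^{n} W(p_i) · |∑_{i=2}^{n} p_i| · |ψ(p₁,…,p_n)| · |φ(p₂,…,p_n)| dp < ∞. Define A₋ψ : ℝ^{n-1} → ℂ by A₋ψ(p₁,…,p_{n-1}) = iβ n (∑_{i=1}^{n-1} p_i) ∫_ℝ W(q) ψ(q, p₁,…,p_{n-1}) dq, and A₊φ : ℝⁿ → ℂ by A₊φ(p₁,…,p_n) = (iβ/n) ∑_{i=1}^{n} (∑_{k ≠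 i} p_k) φ(p₁,…,p̂ᵢ,…,p_n). Then (n-1)! ∫_{ℝ^{n-1}} ∏_{i=1}^{n-1} W(p_i) · (A₋ψ)(p) · conj(φ(p)) dp = − n! ∫_{ℝⁿ} ∏_{i=1}^{n} W(p_i) · ψ(p) · conj((A₊φ)(p)) dp, both integrals being absolutely convergent. -/
open MeasureTheory ENNReal

/-- Kernel-level adjointness relation `(A₋)* = −A₊` (Lemma 2.3): for symmetric chaos
kernels `ψ` (degree `n = k+1`) and `φ` (degree `n−1 = k`), under the stated absolute
integrability, `⟨A₋ψ, φ⟩ = −⟨ψ, A₊φ⟩` with both Fock-space pairings absolutely convergent. -/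
theorem stmt_6 (W : ℝ → ℝ) (hW : Measurable W) (hW0 : ∀ p, 0 ≤ W p)
    (β : ℝ) (hβ : 0 ≤ β) (k : ℕ) (hk : 1 ≤ k)
    (ψ : (Fin (k + 1) → ℝ) → ℂ) (hψ : Measurable ψ)
    (hψsym : ∀ (σ : Equiv.Perm (Fin (k + 1))) (p : Fin (k + 1) → ℝ), ψ (p ∘ σ) = ψ p)
    (φ : (Fin k → ℝ) → ℂ) (hφ : Measurable φ)
    (hφsym : ∀ (σ : Equiv.Perm (Fin k)) (p : Fin k → ℝ), φ (p ∘ σ) = φ p)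
    (hint : Integrable (fun p : Fin (k + 1) → ℝ =>
      (∏ i, W (p i)) * |∑ j : Fin k, p j.succ| * ‖ψ p‖ * ‖φ (Fin.tail p)‖)) :
    Integrable (fun p : Fin k → ℝ =>
        ((∏ i, W (p i) : ℝ) : ℂ) *
          ((Complex.I * (β : ℂ) * ((k : ℂ) + 1) * ((∑ i, p i : ℝ) : ℂ) *
              ∫ q : ℝ, ((W q : ℝ) : ℂ) * ψ (Fin.cons q p)) * starRingEnd ℂ (φ p))) ∧
    Integrable (fun p : Fin (k + 1) → ℝ =>
        ((∏ i, W (p i) : ℝ) : ℂ) *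
          (ψ p * starRingEnd ℂ ((Complex.I * (β : ℂ) / ((k : ℂ) + 1)) *
            ∑ i : Fin (k + 1), ((∑ j ∈ Finset.univ.erase i, p j : ℝ) : ℂ) *
              φ (fun j => p (i.succAbove j))))) ∧
    (Nat.factorial k : ℂ) *
        ∫ p : Fin k → ℝ,
          ((∏ i, W (p i) : ℝ) : ℂ) *
            ((Complex.I * (β : ℂ) * ((k : ℂ) + 1) * ((∑ i, p i : ℝ) : ℂ) *
                ∫ q : ℝ, ((W q : ℝ) : ℂ) * ψ (Fin.cons q p)) * starRingEnd ℂ (φ p))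
      = -((Nat.factorial (k + 1) : ℂ) *
          ∫ p : Fin (k + 1) → ℝ,
            ((∏ i, W (p i) : ℝ) : ℂ) *
              (ψ p * starRingEnd ℂ ((Complex.I * (β : ℂ) / ((k : ℂ) + 1)) *
                ∑ i : Fin (k + 1), ((∑ j ∈ Finset.univ.erase i, p j : ℝ) : ℂ) *
                  φ (fun j => p (i.succAbove j))))) := by
  set H : ℝ × (Fin k → ℝ) → ℂ := fun x =>
    ((W x.1 * ∏ i, W (x.2 i) : ℝ) : ℂ) * ((∑ i, x.2 i : ℝ) : ℂ) * ψ (Fin.cons x.1 x.2) *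
      starRingEnd ℂ (φ x.2) with hH
  have hcons : Measurable (fun x : ℝ × (Fin k → ℝ) => (Fin.cons x.1 x.2 : Fin (k + 1) → ℝ)) := by
    rw [measurable_pi_iff]
    intro a
    refine Fin.cases ?_ (fun j => ?_) a
    · simpa using measurable_fst
    · simp only [Fin.cons_succ]
      exact (measurable_pi_apply j).comp measurable_snd
  have hHm : Measurable H := by
    have h1 : Measurable (fun x : ℝ × (Fin k → ℝ) => ψ (Fin.cons x.1 x.2)) := hψ.comp hcons
    have h2 : Measurable (fun x : ℝ × (Fin k → ℝ) => starRingEnd ℂ (φ x.2)) :=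
      Complex.continuous_conj.measurable.comp (hφ.comp measurable_snd)
    have h3 : Measurable (fun x : ℝ × (Fin k → ℝ) => (W x.1 * ∏ i, W (x.2 i) : ℝ)) := by
      fun_prop
    have h4 : Measurable (fun x : ℝ × (Fin k → ℝ) => (∑ i, x.2 i : ℝ)) := by
      fun_prop
    exact (((Complex.measurable_ofReal.comp h3).mul (Complex.measurable_ofReal.comp h4)).mul
      h1).mul h2
  have hmp := fun i : Fin (k + 1) => volume_preserving_piFinSuccAbove (fun _ : Fin (k + 1) => ℝ) i
  have hterm : ∀ (i : Fin (k + 1)) (p : Fin (k + 1) → ℝ),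
      H (MeasurableEquiv.piFinSuccAbove (fun _ : Fin (k + 1) => ℝ) i p) =
        ((∏ i, W (p i) : ℝ) : ℂ) * ((∑ j ∈ Finset.univ.erase i, p j : ℝ) : ℂ) * ψ p *
          starRingEnd ℂ (φ (fun j => p (i.succAbove j))) := by
    intro i p
    have e1 : MeasurableEquiv.piFinSuccAbove (fun _ : Fin (k + 1) => ℝ) i p =
        (p i, fun j => p (i.succAbove j)) := rfl
    have e2 : (Fin.cons (p i) (fun j => p (i.succAbove j)) : Fin (k + 1) → ℝ) =
        p ∘ i.cycleRange.symm := by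
      funext a
      refine Fin.cases ?_ (fun j => ?_) a
      · simp [Fin.cycleRange_symm_zero]
      · simp [Fin.cycleRange_symm_succ]
    have e3 : ∑ j ∈ Finset.univ.erase i, p j = ∑ j, p (i.succAbove j) := by
      have a1 := Finset.add_sum_erase Finset.univ p (Finset.mem_univ i)
      have a2 := Fin.sum_univ_succAbove p i
      linarith
    rw [e1, e3, Fin.prod_univ_succAbove (fun a => W (p a)) i, hH]
    simp only
    rw [e2, hψsym]
  have hHint : Integrable H (volume.prod volume) := by
    have h0 : Integrable
        (H ∘ MeasurableEquiv.piFinSuccAbove (fun _ : Fin (k + 1) => ℝ) 0) volume := by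
      refine hint.mono' (hHm.comp (MeasurableEquiv.measurable _)).aestronglyMeasurable ?_
      refine Filter.Eventually.of_forall fun p => le_of_eq ?_
      have a1 : ∑ j ∈ Finset.univ.erase (0 : Fin (k + 1)), p j = ∑ j : Fin k, p j.succ := by
        have a1 := Finset.add_sum_erase Finset.univ p (Finset.mem_univ 0)
        have a2 := Fin.sum_univ_succ p
        linarith
      have a2 : (fun j => p ((0 : Fin (k + 1)).succAbove j)) = Fin.tail p := by
        funext j
        simp [Fin.tail]
      rw [Function.comp_apply, hterm, a1, a2, norm_mul, norm_mul, norm_mul, Complex.norm_real,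
        Complex.norm_real, RCLike.norm_conj, Real.norm_eq_abs, Real.norm_eq_abs,
        abs_of_nonneg (Finset.prod_nonneg fun i _ => hW0 (p i))]
    exact ((hmp 0).integrable_comp_emb (MeasurableEquiv.measurableEmbedding _)).1 h0
  have hTint : ∀ i : Fin (k + 1), Integrable (fun p : Fin (k + 1) → ℝ =>
      H (MeasurableEquiv.piFinSuccAbove (fun _ : Fin (k + 1) => ℝ) i p)) := fun i =>
    ((hmp i).integrable_comp_emb (MeasurableEquiv.measurableEmbedding _)).2 hHint
  have hTval : ∀ i : Fin (k + 1), ∫ p : Fin (k + 1) → ℝ,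
      H (MeasurableEquiv.piFinSuccAbove (fun _ : Fin (k + 1) => ℝ) i p) =
        ∫ x, H x ∂(volume.prod volume) := fun i =>
    (hmp i).integral_comp (MeasurableEquiv.measurableEmbedding _) H
  have hL : (fun p : Fin k → ℝ =>
        ((∏ i, W (p i) : ℝ) : ℂ) *
          ((Complex.I * (β : ℂ) * ((k : ℂ) + 1) * ((∑ i, p i : ℝ) : ℂ) *
              ∫ q : ℝ, ((W q : ℝ) : ℂ) * ψ (Fin.cons q p)) * starRingEnd ℂ (φ p))) =
      fun p => (Complex.I * (β : ℂ) * ((k : ℂ) + 1)) * ∫ q, H (q, p) := by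
    funext p
    have : ∀ q, H (q, p) = (((∏ i, W (p i) : ℝ) : ℂ) * ((∑ i, p i : ℝ) : ℂ) *
        starRingEnd ℂ (φ p)) * (((W q : ℝ) : ℂ) * ψ (Fin.cons q p)) := by
      intro q
      simp only [hH, Complex.ofReal_mul]
      ring
    simp only [this]
    rw [integral_const_mul]
    ring
  have hR : (fun p : Fin (k + 1) → ℝ =>
        ((∏ i, W (p i) : ℝ) : ℂ) *
          (ψ p * starRingEnd ℂ ((Complex.I * (β : ℂ) / ((k : ℂ) + 1)) *
            ∑ i : Fin (k + 1), ((∑ j ∈ Finset.univ.erase i, p j : ℝ) : ℂ) *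
              φ (fun j => p (i.succAbove j))))) =
      fun p => (-(Complex.I * (β : ℂ) / ((k : ℂ) + 1))) * ∑ i : Fin (k + 1),
        H (MeasurableEquiv.piFinSuccAbove (fun _ : Fin (k + 1) => ℝ) i p) := by
    funext p
    have hc : starRingEnd ℂ (Complex.I * (β : ℂ) / ((k : ℂ) + 1)) =
        -(Complex.I * (β : ℂ) / ((k : ℂ) + 1)) := by
      simp only [map_div₀, map_mul, Complex.conj_I, Complex.conj_ofReal, map_add, map_natCast,
        map_one]
      ring
    simp only [hterm]
    rw [map_mul, hc, map_sum, Finset.mul_sum, Finset.mul_sum, Finset.mul_sum, Finset.mul_sum]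
    refine Finset.sum_congr rfl fun i _ => ?_
    rw [map_mul, Complex.conj_ofReal]
    ring
  rw [hL, hR]
  refine ⟨hHint.integral_prod_right.const_mul _,
    (integrable_finsetSum _ fun i _ => hTint i).const_mul _, ?_⟩
  rw [integral_const_mul, integral_const_mul, integral_finsetSum _ fun i _ => hTint i]
  simp only [hTval]
  rw [integral_prod_symm H hHint, Finset.sum_const, Finset.card_univ, Fintype.card_fin,
    Nat.factorial_succ, nsmul_eq_mul]
  push_cast
  have hk1 : (k : ℂ) + 1 ≠ 0 := by exact_mod_cast Nat.succ_ne_zero k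
  field_simp
end

section
/- Let W : ℝ → [0,∞) be measurable and K := sup_{a ∈ ℝ} ∫_ℝ W(q)/(1 + |a+q|²/2) dq < ∞. Then for every measurable h : ℝ → ℂ, the following inequality holds in [0,∞]: ∫_ℝ ∫_ℝ W(p) W(q) · |p·h(p) + q·h(q)|² / (1 + |p+q|²/2) dp dq ≤ 4 K ∫_ℝ W(p) · p² · |h(p)|² dp. -/
open MeasureTheory ENNReal

/-- Proposition 3.9 (explicit content): with `K = sup_a ∫ W(q)/(1+|a+q|²/2) dq < ∞`,
`∫∫ W(p)W(q) |p h(p) + q h(q)|² / (1 + |p+q|²/2) dp dq ≤ 4K ∫ W(p) p² |h(p)|² dp`. -/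
theorem stmt_7 (W : ℝ → ℝ) (hW : Measurable W) (hW0 : ∀ p, 0 ≤ W p)
    (K : ℝ≥0∞) (hK : K = ⨆ a : ℝ, ∫⁻ q, ENNReal.ofReal (W q / (1 + (a + q) ^ 2 / 2)))
    (hKfin : K ≠ ⊤)
    (h : ℝ → ℂ) (hh : Measurable h) :
    ∫⁻ p, ∫⁻ q, ENNReal.ofReal
        (W p * W q * ‖(p : ℂ) * h p + (q : ℂ) * h q‖ ^ 2 / (1 + (p + q) ^ 2 / 2))
      ≤ 4 * K * ∫⁻ p, ENNReal.ofReal (W p * p ^ 2 * ‖h p‖ ^ 2) := by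
  have hA : ∀ p : ℝ, ∫⁻ q, 2 * (ENNReal.ofReal (W p * p ^ 2 * ‖h p‖ ^ 2)
      * ENNReal.ofReal (W q / (1 + (p + q) ^ 2 / 2)))
      ≤ 2 * K * ENNReal.ofReal (W p * p ^ 2 * ‖h p‖ ^ 2) := by
    intro p
    rw [lintegral_const_mul _ (by fun_prop), lintegral_const_mul _ (by fun_prop)]
    have : ∫⁻ q, ENNReal.ofReal (W q / (1 + (p + q) ^ 2 / 2)) ≤ K := by
      rw [hK]
      exact le_iSup (fun a : ℝ => ∫⁻ q, ENNReal.ofReal (W q / (1 + (a + q) ^ 2 / 2))) p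
    rw [mul_assoc 2 K, mul_comm K]
    gcongr
  have hB : ∫⁻ p, ∫⁻ q, 2 * (ENNReal.ofReal (W p * p ^ 2 * ‖h p‖ ^ 2)
      * ENNReal.ofReal (W q / (1 + (p + q) ^ 2 / 2)))
      ≤ 2 * K * ∫⁻ p, ENNReal.ofReal (W p * p ^ 2 * ‖h p‖ ^ 2) := by
    rw [← lintegral_const_mul _ (by fun_prop)]
    exact lintegral_mono hA
  have hC : ∫⁻ p, ∫⁻ q, 2 * (ENNReal.ofReal (W q * q ^ 2 * ‖h q‖ ^ 2)
      * ENNReal.ofReal (W p / (1 + (q + p) ^ 2 / 2)))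
      ≤ 2 * K * ∫⁻ p, ENNReal.ofReal (W p * p ^ 2 * ‖h p‖ ^ 2) := by
    rw [lintegral_lintegral_swap]
    · exact hB
    · apply Measurable.aemeasurable
      unfold Function.uncurry
      fun_prop
  have hpt : ∀ p q : ℝ, ENNReal.ofReal
      (W p * W q * ‖(p : ℂ) * h p + (q : ℂ) * h q‖ ^ 2 / (1 + (p + q) ^ 2 / 2))
      ≤ 2 * (ENNReal.ofReal (W p * p ^ 2 * ‖h p‖ ^ 2)
          * ENNReal.ofReal (W q / (1 + (p + q) ^ 2 / 2)))
        + 2 * (ENNReal.ofReal (W q * q ^ 2 * ‖h q‖ ^ 2)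
          * ENNReal.ofReal (W p / (1 + (q + p) ^ 2 / 2))) := by
    intro p q
    have hp := hW0 p
    have hq := hW0 q
    have h2 : (2 : ℝ≥0∞) = ENNReal.ofReal 2 := by simp
    rw [h2, ← ENNReal.ofReal_mul (by positivity), ← ENNReal.ofReal_mul (by positivity),
      ← ENNReal.ofReal_mul (by positivity), ← ENNReal.ofReal_mul (by positivity),
      ← ENNReal.ofReal_add (by positivity) (by positivity)]
    apply ENNReal.ofReal_le_ofReal
    have hn : ‖(p : ℂ) * h p + (q : ℂ) * h q‖ ^ 2
        ≤ 2 * (p ^ 2 * ‖h p‖ ^ 2) + 2 * (q ^ 2 * ‖h q‖ ^ 2) := by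
      have h1 := norm_add_le ((p : ℂ) * h p) ((q : ℂ) * h q)
      have h3 : ‖(p : ℂ) * h p‖ ^ 2 = p ^ 2 * ‖h p‖ ^ 2 := by
        rw [norm_mul, mul_pow, Complex.norm_real, Real.norm_eq_abs, sq_abs]
      have h4 : ‖(q : ℂ) * h q‖ ^ 2 = q ^ 2 * ‖h q‖ ^ 2 := by
        rw [norm_mul, mul_pow, Complex.norm_real, Real.norm_eq_abs, sq_abs]
      rw [← h3, ← h4]
      have h5 := pow_le_pow_left₀ (norm_nonneg _) h1 2
      nlinarith [sq_nonneg (‖(p : ℂ) * h p‖ - ‖(q : ℂ) * h q‖)]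
    calc _ ≤ W p * W q * (2 * (p ^ 2 * ‖h p‖ ^ 2) + 2 * (q ^ 2 * ‖h q‖ ^ 2))
          / (1 + (p + q) ^ 2 / 2) := by gcongr
      _ = _ := by rw [add_comm q p]; ring
  calc _ ≤ ∫⁻ p, ∫⁻ q, (2 * (ENNReal.ofReal (W p * p ^ 2 * ‖h p‖ ^ 2)
          * ENNReal.ofReal (W q / (1 + (p + q) ^ 2 / 2)))
        + 2 * (ENNReal.ofReal (W q * q ^ 2 * ‖h q‖ ^ 2)
          * ENNReal.ofReal (W p / (1 + (q + p) ^ 2 / 2)))) :=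
        lintegral_mono fun p => lintegral_mono fun q => hpt p q
    _ = (∫⁻ p, ∫⁻ q, 2 * (ENNReal.ofReal (W p * p ^ 2 * ‖h p‖ ^ 2)
          * ENNReal.ofReal (W q / (1 + (p + q) ^ 2 / 2))))
        + ∫⁻ p, ∫⁻ q, 2 * (ENNReal.ofReal (W q * q ^ 2 * ‖h q‖ ^ 2)
          * ENNReal.ofReal (W p / (1 + (q + p) ^ 2 / 2))) := by
        rw [← lintegral_add_left]
        · congr 1
          ext p
          rw [lintegral_add_left (by fun_prop)]
        · apply Measurable.lintegral_prod_right
          unfold Function.uncurry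
          fun_prop
    _ ≤ _ := add_le_add hB hC
    _ = _ := by ring
end

section
/- Let α > −1 and let W : ℝ → [0,∞) be measurable with W(p) ≤ C₀ |p|^α for all p with 0 < |p| ≤ δ, for some constants C₀, δ > 0. Let h : ℝ → ℂ be continuous with support contained in [−1,1]. Then there exists a constant C > 0 such that for every real m ≥ max(1, 1/δ) and every Y ∈ ℝ, | ∫_{−1}^{1} W(p/m) · p · h(p) · (1 − e^{i p Y / m}) dp | ≤ C · |Y| · m^{−α−1}. -/
open MeasureTheory ENNReal

/-- Lemma 6.8 (vanishing of the `Q^m` term), Fourier-side estimate: if `W(p) ≤ C₀|p|^α`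
near `0` with `α > −1` and `h` is continuous with support in `[−1,1]`, then
`|∫_{−1}^1 W(p/m) p h(p) (1 − e^{ipY/m}) dp| ≤ C |Y| m^{−α−1}` uniformly in `Y` and
`m ≥ max(1, 1/δ)`. -/
theorem stmt_8 (α : ℝ) (hα : -1 < α) (W : ℝ → ℝ) (hW : Measurable W) (hW0 : ∀ p, 0 ≤ W p)
    (C₀ δ : ℝ) (hC₀ : 0 < C₀) (hδ : 0 < δ)
    (hWb : ∀ p : ℝ, 0 < |p| → |p| ≤ δ → W p ≤ C₀ * |p| ^ α)
    (h : ℝ → ℂ) (hh : Continuous h) (hsupp : Function.support h ⊆ Set.Icc (-1 : ℝ) 1) :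
    ∃ C : ℝ, 0 < C ∧ ∀ m : ℝ, max 1 (1 / δ) ≤ m → ∀ Y : ℝ,
      ‖∫ p in Set.Icc (-1 : ℝ) 1,
          ((W (p / m) * p : ℝ) : ℂ) * h p *
            (1 - Complex.exp (Complex.I * (p : ℂ) * (Y : ℂ) / (m : ℂ)))‖
        ≤ C * |Y| * m ^ (-α - 1) := by
  obtain ⟨H, hH⟩ := isCompact_Icc.exists_bound_of_continuousOn
    (hh.continuousOn (s := Set.Icc (-1 : ℝ) 1))
  have hH0 : 0 ≤ H := (norm_nonneg _).trans (hH 0 (by constructor <;> norm_num))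
  refine ⟨C₀ * (H + 1) * 2, by positivity, ?_⟩
  intro m hm Y
  have hm1 : 1 ≤ m := (le_max_left _ _).trans hm
  have hmδ : 1 / δ ≤ m := (le_max_right _ _).trans hm
  have hm0 : 0 < m := by linarith
  have hδm : 1 / m ≤ δ := by
    rw [div_le_iff₀ hδ] at hmδ
    rw [div_le_iff₀ hm0]
    linarith
  have hmp : 0 < m ^ (-α - 1) := Real.rpow_pos_of_pos hm0 _
  have key : ∀ p ∈ Set.Icc (-1 : ℝ) 1,
      ‖((W (p / m) * p : ℝ) : ℂ) * h p *
            (1 - Complex.exp (Complex.I * (p : ℂ) * (Y : ℂ) / (m : ℂ)))‖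
        ≤ C₀ * (H + 1) * |Y| * m ^ (-α - 1) := by
    intro p hp
    rcases eq_or_ne p 0 with rfl | hp0
    · simp
      positivity
    have hpa : 0 < |p| := abs_pos.mpr hp0
    have hp1 : |p| ≤ 1 := abs_le.mpr hp
    have habs : |p / m| = |p| / m := by rw [abs_div, abs_of_pos hm0]
    have hWp : W (p / m) ≤ C₀ * (|p| / m) ^ α := by
      have := hWb (p / m) (by rw [habs]; positivity)
        (by rw [habs]; exact le_trans (by gcongr) hδm)
      rwa [habs] at this
    have hexp : ‖1 - Complex.exp (Complex.I * (p : ℂ) * (Y : ℂ) / (m : ℂ))‖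
        ≤ |p| * |Y| / m := by
      have h1 := Real.norm_exp_I_mul_ofReal_sub_one_le (x := p * Y / m)
      rw [norm_sub_rev]
      have h2 : Complex.I * (p : ℂ) * (Y : ℂ) / (m : ℂ)
          = Complex.I * ((p * Y / m : ℝ) : ℂ) := by
        push_cast
        ring
      rw [h2]
      refine h1.trans (le_of_eq ?_)
      rw [Real.norm_eq_abs, abs_div, abs_mul, abs_of_pos hm0]
    rw [norm_mul, norm_mul, Complex.norm_real, Real.norm_eq_abs, abs_mul,
      abs_of_nonneg (hW0 _)]
    have hr : (|p| / m) ^ α * |p| * (|p| * |Y| / m) = |p| ^ (α + 2) * |Y| * m ^ (-α - 1) := by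
      rw [Real.div_rpow hpa.le hm0.le, Real.rpow_add hpa, Real.rpow_sub hm0,
        Real.rpow_neg hm0.le, Real.rpow_one, Real.rpow_two]
      have := Real.rpow_pos_of_pos hm0 α
      field_simp
    have hle : |p| ^ (α + 2) ≤ 1 := Real.rpow_le_one hpa.le hp1 (by linarith)
    calc W (p / m) * |p| * ‖h p‖ * _
        ≤ (C₀ * (|p| / m) ^ α) * |p| * (H + 1) * (|p| * |Y| / m) := by
          gcongr
          linarith [hH p hp]
      _ = C₀ * (H + 1) * ((|p| / m) ^ α * |p| * (|p| * |Y| / m)) := by ring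
      _ = C₀ * (H + 1) * (|p| ^ (α + 2) * |Y| * m ^ (-α - 1)) := by rw [hr]
      _ ≤ C₀ * (H + 1) * (1 * |Y| * m ^ (-α - 1)) := by gcongr
      _ = _ := by ring
  refine (norm_setIntegral_le_of_norm_le_const (by simp) key).trans (le_of_eq ?_)
  rw [Measure.real, Real.volume_Icc, ENNReal.toReal_ofReal (by norm_num)]
  ring
end

section
/- Let α ∈ (−1, 1) and let W : ℝ → [0,∞) be measurable with M := sup_{z ∈ ℤ} ∫_z^{z+1} W(p) dp < ∞ and W(p) ≤ C₀ |p|^α for all p with 0 < |p| ≤ R₀, for some constants C₀, R₀ > 0. Then there exists C > 0 such that for all λ ∈ (0, 1], ∫_ℝ W(q) / (λ + q²/2) dq ≤ C · λ^{(α−1)/2}. -/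
open MeasureTheory ENNReal

lemma aux_int_s10 (α : ℝ) (hα : -1 < α) (hα' : α < 1) :
    Integrable (fun u : ℝ => |u| ^ α / (1 + u ^ 2 / 2)) := by
  have hmeas : Measurable (fun u : ℝ => |u| ^ α / (1 + u ^ 2 / 2)) := by
    fun_prop
  have h1 : IntegrableOn (fun u : ℝ => |u| ^ α / (1 + u ^ 2 / 2)) (Set.Ioc 0 1) := by
    have h : IntegrableOn (fun u : ℝ => u ^ α) (Set.Ioc 0 1) := by
      have := intervalIntegral.intervalIntegrable_rpow' (a := 0) (b := 1) hα
      rwa [intervalIntegrable_iff_integrableOn_Ioc_of_le zero_le_one] at this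
    refine Integrable.mono' h hmeas.aestronglyMeasurable ?_
    filter_upwards [ae_restrict_mem measurableSet_Ioc] with u hu
    have hp : 0 ≤ u ^ α := Real.rpow_nonneg hu.1.le _
    rw [abs_of_pos hu.1, Real.norm_of_nonneg (by positivity)]
    exact div_le_self hp (by nlinarith [sq_nonneg u])
  have h2 : IntegrableOn (fun u : ℝ => |u| ^ α / (1 + u ^ 2 / 2)) (Set.Ioi 1) := by
    have h : IntegrableOn (fun u : ℝ => 2 * u ^ (α - 2)) (Set.Ioi 1) :=
      (integrableOn_Ioi_rpow_of_lt (by linarith) zero_lt_one).const_mul 2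
    refine Integrable.mono' h hmeas.aestronglyMeasurable ?_
    filter_upwards [ae_restrict_mem measurableSet_Ioi] with u hu
    have hu0 : 0 < u := lt_trans zero_lt_one hu
    have hp : 0 ≤ u ^ α := Real.rpow_nonneg hu0.le _
    rw [abs_of_pos hu0, Real.norm_of_nonneg (by positivity), Real.rpow_sub hu0, Real.rpow_two,
      ← mul_div_assoc, div_le_div_iff₀ (by positivity) (by positivity)]
    nlinarith
  have h3 : IntegrableOn (fun u : ℝ => |u| ^ α / (1 + u ^ 2 / 2)) (Set.Ioi 0) := by
    rw [← Set.Ioc_union_Ioi_eq_Ioi zero_le_one]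
    exact h1.union h2
  have h4 : IntegrableOn (fun u : ℝ => |u| ^ α / (1 + u ^ 2 / 2)) (Set.Iic 0) := by
    rw [← Measure.map_neg_eq_self (volume : Measure ℝ)]
    let m : MeasurableEmbedding fun x : ℝ => -x := (Homeomorph.neg ℝ).measurableEmbedding
    rw [m.integrableOn_map_iff]
    simp_rw [Function.comp_def, abs_neg, Set.neg_preimage, Set.neg_Iic, neg_zero, neg_sq]
    exact Iff.mpr integrableOn_Ici_iff_integrableOn_Ioi h3
  rw [← integrableOn_univ, ← Set.Iic_union_Ioi (a := (0 : ℝ))]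
  exact h4.union h3

lemma aux_scale (α lam : ℝ) (hα : -1 < α) (hα' : α < 1) (hl : 0 < lam) :
    ∫⁻ q : ℝ, ENNReal.ofReal (|q| ^ α / (lam + q ^ 2 / 2)) =
      ENNReal.ofReal (lam ^ ((α - 1) / 2) * ∫ u : ℝ, |u| ^ α / (1 + u ^ 2 / 2)) := by
  set s := lam ^ (1 / 2 : ℝ) with hs
  have hs0 : 0 < s := Real.rpow_pos_of_pos hl _
  have hs2 : s ^ 2 = lam := by
    rw [hs, ← Real.rpow_natCast, ← Real.rpow_mul hl.le]; norm_num
  have hse : lam ^ ((α - 1) / 2) = s ^ α / s := by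
    rw [hs, ← Real.rpow_mul hl.le, ← Real.rpow_sub hl]; congr 1; ring
  have hfun : (fun q : ℝ => |q| ^ α / (lam + q ^ 2 / 2)) = fun q : ℝ =>
      (s ^ α / s ^ 2) * ((fun u : ℝ => |u| ^ α / (1 + u ^ 2 / 2)) (q / s)) := by
    funext q
    have hsa : 0 < s ^ α := Real.rpow_pos_of_pos hs0 _
    simp only [abs_div, abs_of_pos hs0]
    rw [Real.div_rpow (abs_nonneg _) hs0.le, ← hs2]
    have h1 : s ^ 2 + q ^ 2 / 2 ≠ 0 := by positivity
    have h2 : 1 + (q / s) ^ 2 / 2 ≠ 0 := by positivity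
    have h3 : 1 + (q / s) ^ 2 / 2 = (s ^ 2 + q ^ 2 / 2) / s ^ 2 := by field_simp
    rw [h3]
    field_simp
  have hint := ((aux_int_s10 α hα hα').comp_div hs0.ne').const_mul (s ^ α / s ^ 2)
  rw [← ofReal_integral_eq_lintegral_ofReal]
  · rw [hfun, integral_const_mul,
      Measure.integral_comp_div (fun u : ℝ => |u| ^ α / (1 + u ^ 2 / 2)), abs_of_pos hs0,
      hse, smul_eq_mul]
    generalize (∫ u : ℝ, |u| ^ α / (1 + u ^ 2 / 2)) = I
    congr 1
    field_simp
  · rw [hfun]; exact hint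
  · exact Filter.Eventually.of_forall fun q => by
      have := Real.rpow_nonneg (abs_nonneg q) α
      simp only [Pi.zero_apply]
      positivity

lemma aux_tail (W : ℝ → ℝ) (hW0 : ∀ p, 0 ≤ W p) (M : ℝ)
    (hM : ∀ z : ℤ, ∫⁻ p in Set.Ioc (z : ℝ) (z + 1), ENNReal.ofReal (W p) ≤ ENNReal.ofReal M) :
    ∫⁻ q, ENNReal.ofReal (W q / (1 + q ^ 2)) < ∞ := by
  have hsum : Summable fun z : ℤ => 3 / (1 + (z : ℝ) ^ 2) := by
    have h := ((Real.summable_one_div_int_pow (p := 2)).2 (by norm_num)).mul_left 3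
    refine Summable.of_norm_bounded_eventually h ?_
    have : ∀ᶠ z : ℤ in Filter.cofinite, z ≠ 0 :=
      (Set.finite_singleton (0 : ℤ)).eventually_cofinite_notMem
    filter_upwards [this] with z hz
    have hz' : (z : ℝ) ≠ 0 := by exact_mod_cast hz
    rw [Real.norm_of_nonneg (by positivity), mul_one_div]
    gcongr
    linarith
  have hz : ∀ z : ℤ, ∫⁻ q in Set.Ioc (z : ℝ) (z + 1), ENNReal.ofReal (W q / (1 + q ^ 2)) ≤
      ENNReal.ofReal (3 / (1 + (z : ℝ) ^ 2)) * ENNReal.ofReal M := by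
    intro z
    calc _ ≤ ∫⁻ q in Set.Ioc (z : ℝ) (z + 1),
          ENNReal.ofReal (3 / (1 + (z : ℝ) ^ 2)) * ENNReal.ofReal (W q) := by
          refine setLIntegral_mono' measurableSet_Ioc fun q hq => ?_
          rw [← ENNReal.ofReal_mul (by positivity)]
          apply ENNReal.ofReal_le_ofReal
          rw [div_mul_eq_mul_div, div_le_div_iff₀ (by positivity) (by positivity)]
          have : 1 + (z : ℝ) ^ 2 ≤ 3 * (1 + q ^ 2) := by
            nlinarith [hq.1, hq.2, sq_nonneg (2 * q - z)]
          nlinarith [mul_le_mul_of_nonneg_left this (hW0 q)]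
      _ = ENNReal.ofReal (3 / (1 + (z : ℝ) ^ 2)) *
          ∫⁻ q in Set.Ioc (z : ℝ) (z + 1), ENNReal.ofReal (W q) :=
          lintegral_const_mul' _ _ ENNReal.ofReal_ne_top
      _ ≤ _ := by gcongr; exact hM z
  calc _ = ∫⁻ q in ⋃ z : ℤ, Set.Ioc (z : ℝ) (z + 1), ENNReal.ofReal (W q / (1 + q ^ 2)) := by
        rw [iUnion_Ioc_intCast, Measure.restrict_univ]
    _ ≤ ∑' z : ℤ, ∫⁻ q in Set.Ioc (z : ℝ) (z + 1), ENNReal.ofReal (W q / (1 + q ^ 2)) :=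
        lintegral_iUnion_le _ _
    _ ≤ ∑' z : ℤ, ENNReal.ofReal (3 / (1 + (z : ℝ) ^ 2)) * ENNReal.ofReal M :=
        ENNReal.tsum_le_tsum hz
    _ < ∞ := by
        rw [ENNReal.tsum_mul_right]
        refine ENNReal.mul_lt_top ?_ ENNReal.ofReal_lt_top
        rw [← ENNReal.ofReal_tsum_of_nonneg (fun z => by positivity) hsum]
        exact ENNReal.ofReal_lt_top

/-- Upper-bound half of the superdiffusivity estimate (proof of Theorem 1.4):
under uniform local integrability and the infrared bound `W(p) ≤ C₀|p|^α` near `0`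
with `α ∈ (−1,1)`, one has `∫ W(q)/(λ + q²/2) dq ≤ C λ^{(α−1)/2}` for `λ ∈ (0,1]`. -/
theorem stmt_10 (α : ℝ) (hα : -1 < α) (hα' : α < 1)
    (W : ℝ → ℝ) (hW : Measurable W) (hW0 : ∀ p, 0 ≤ W p)
    (M : ℝ)
    (hM : ∀ z : ℤ, ∫⁻ p in Set.Ioc (z : ℝ) (z + 1), ENNReal.ofReal (W p) ≤ ENNReal.ofReal M)
    (C₀ R₀ : ℝ) (hC₀ : 0 < C₀) (hR₀ : 0 < R₀)
    (hWb : ∀ p : ℝ, 0 < |p| → |p| ≤ R₀ → W p ≤ C₀ * |p| ^ α) :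
    ∃ C : ℝ, 0 < C ∧ ∀ lam : ℝ, 0 < lam → lam ≤ 1 →
      ∫⁻ q, ENNReal.ofReal (W q / (lam + q ^ 2 / 2))
        ≤ ENNReal.ofReal (C * lam ^ ((α - 1) / 2)) := by
  set K := ∫ u : ℝ, |u| ^ α / (1 + u ^ 2 / 2) with hK
  have hK0 : 0 ≤ K := integral_nonneg fun u => by
    have := Real.rpow_nonneg (abs_nonneg u) α
    simp only [Pi.zero_apply]
    positivity
  set T := ∫⁻ q, ENNReal.ofReal (W q / (1 + q ^ 2)) with hT
  have hTt : T ≠ ∞ := (aux_tail W hW0 M hM).ne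
  set A := 2 * (1 + 1 / R₀ ^ 2) with hA
  have hA0 : 0 < A := by positivity
  refine ⟨C₀ * K + A * T.toReal + 1, by positivity, fun lam hl hl1 => ?_⟩
  have hL : 1 ≤ lam ^ ((α - 1) / 2) :=
    Real.one_le_rpow_of_pos_of_le_one_of_nonpos hl hl1 (by linarith)
  have hpt : ∀ᵐ q : ℝ, ENNReal.ofReal (W q / (lam + q ^ 2 / 2)) ≤
      ENNReal.ofReal C₀ * ENNReal.ofReal (|q| ^ α / (lam + q ^ 2 / 2)) +
      ENNReal.ofReal A * ENNReal.ofReal (W q / (1 + q ^ 2)) := by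
    have h0 : ∀ᵐ q : ℝ, q ≠ 0 := by simp [ae_iff]
    filter_upwards [h0] with q hq
    have hq2 : 0 < q ^ 2 := by positivity
    rcases le_or_gt |q| R₀ with h | h
    · refine le_trans ?_ le_self_add
      rw [← ENNReal.ofReal_mul hC₀.le]
      apply ENNReal.ofReal_le_ofReal
      rw [← mul_div_assoc]
      gcongr
      exact hWb q (abs_pos.2 hq) h
    · refine le_trans ?_ le_add_self
      rw [← ENNReal.ofReal_mul hA0.le]
      apply ENNReal.ofReal_le_ofReal
      have hR : R₀ ^ 2 ≤ q ^ 2 := by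
        rw [← sq_abs q]; gcongr
      have h1 : 1 ≤ q ^ 2 / R₀ ^ 2 := by rwa [one_le_div (by positivity)]
      have h2 : 1 + q ^ 2 ≤ A * (lam + q ^ 2 / 2) := by
        have e : A * (lam + q ^ 2 / 2) = A * lam + q ^ 2 + q ^ 2 / R₀ ^ 2 := by
          rw [hA]; field_simp; ring
        have := mul_pos hA0 hl
        linarith
      rw [← mul_div_assoc, div_le_div_iff₀ (by positivity) (by positivity)]
      nlinarith [mul_le_mul_of_nonneg_left h2 (hW0 q)]
  calc _ ≤ _ := lintegral_mono_ae hpt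
    _ = ENNReal.ofReal C₀ * ENNReal.ofReal (lam ^ ((α - 1) / 2) * K) + ENNReal.ofReal A * T := by
        rw [lintegral_add_left (by fun_prop), lintegral_const_mul' _ _ ENNReal.ofReal_ne_top,
          lintegral_const_mul' _ _ ENNReal.ofReal_ne_top, aux_scale α lam hα hα' hl]
    _ = ENNReal.ofReal (C₀ * (lam ^ ((α - 1) / 2) * K) + A * T.toReal) := by
        rw [ENNReal.ofReal_add (by positivity) (by positivity), ENNReal.ofReal_mul hC₀.le,
          ENNReal.ofReal_mul hA0.le, ENNReal.ofReal_toReal hTt]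
    _ ≤ _ := by
        apply ENNReal.ofReal_le_ofReal
        have : 0 ≤ A * T.toReal := by positivity
        nlinarith [mul_le_mul_of_nonneg_left hL this]
end

section
/- Let W : ℝ → [0,∞) be measurable with M := sup_{z ∈ ℤ} ∫_z^{z+1} W(p) dp < ∞, let H : ℝ → [0,∞) be measurable with I := ∫_ℝ W(p) H(p) (1+|p|)³ dp < ∞, and let g : ℝ → ℝ satisfy g(0) = 1, |g(x)| ≤ B for all x, and |g(x) − g(y)| ≤ L|x − y| for all x, y. Then there exists C > 0 (depending only on M, I, B, L) such that for all N ≥ 1, ∫_ℝ ∫_ℝ W(p) W(q) · H(p) · (g(q/N) − 1)² / (1 + (p+q)²/2) dp dq ≤ C · N^{−1/2}. -/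
open MeasureTheory ENNReal

/-- The summable majorant on the integers. -/
noncomputable def majA (n : ℤ) : ℝ := 1 / |(n : ℝ) + 1 / 2| ^ (3 / 2 : ℝ)

lemma majA_nonneg (n : ℤ) : 0 ≤ majA n := by unfold majA; positivity

lemma majA_summable : Summable majA := by
  unfold majA
  exact (Real.summable_one_div_int_add_rpow (1 / 2) (3 / 2)).2 (by norm_num)

lemma weight_bound (n : ℤ) (s : ℝ) (h1 : (n : ℝ) ≤ s) (h2 : s ≤ n + 2) :
    Real.sqrt (1 + |s|) / (1 + s ^ 2 / 2) ≤ 16 * majA n := by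
  have hs := abs_nonneg s
  have hu : 0 < 1 + |s| := by positivity
  have hn : |(n : ℝ) + 1 / 2| ≤ 2 * (1 + |s|) := by
    rw [abs_le]
    constructor <;> linarith [neg_abs_le s, le_abs_self s]
  have hn0 : 0 < |(n : ℝ) + 1 / 2| := by
    rw [abs_pos]
    intro h
    have h3 : ((2 * n + 1 : ℤ) : ℝ) = ((0 : ℤ) : ℝ) := by push_cast; linarith
    have h4 := Int.cast_injective h3
    omega
  have hpow : |(n : ℝ) + 1 / 2| ^ (3 / 2 : ℝ) ≤ 4 * (1 + |s|) ^ (3 / 2 : ℝ) := by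
    calc |(n : ℝ) + 1 / 2| ^ (3 / 2 : ℝ) ≤ (2 * (1 + |s|)) ^ (3 / 2 : ℝ) :=
          Real.rpow_le_rpow hn0.le hn (by norm_num)
      _ = 2 ^ (3 / 2 : ℝ) * (1 + |s|) ^ (3 / 2 : ℝ) := Real.mul_rpow (by norm_num) hu.le
      _ ≤ 4 * (1 + |s|) ^ (3 / 2 : ℝ) := by
          gcongr
          calc (2 : ℝ) ^ (3 / 2 : ℝ) ≤ 2 ^ (2 : ℝ) :=
                Real.rpow_le_rpow_of_exponent_le (by norm_num) (by norm_num)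
            _ = 4 := by norm_num
  have hP : 0 < |(n : ℝ) + 1 / 2| ^ (3 / 2 : ℝ) := Real.rpow_pos_of_pos hn0 _
  have hmul : Real.sqrt (1 + |s|) * (1 + |s|) ^ (3 / 2 : ℝ) = (1 + |s|) ^ 2 := by
    rw [Real.sqrt_eq_rpow, ← Real.rpow_add hu]
    norm_num
  unfold majA
  rw [mul_one_div, div_le_div_iff₀ (by positivity) hP]
  calc Real.sqrt (1 + |s|) * |(n : ℝ) + 1 / 2| ^ (3 / 2 : ℝ)
      ≤ Real.sqrt (1 + |s|) * (4 * (1 + |s|) ^ (3 / 2 : ℝ)) := by gcongr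
    _ = 4 * (1 + |s|) ^ 2 := by rw [← hmul]; ring
    _ ≤ 16 * (1 + s ^ 2 / 2) := by nlinarith [sq_abs s, sq_nonneg (|s| - 1)]

lemma g_bound (B L : ℝ) (g : ℝ → ℝ) (h0 : g 0 = 1) (hB : ∀ x, |g x| ≤ B)
    (hL : ∀ x y, |g x - g y| ≤ L * |x - y|) (x : ℝ) :
    (g x - 1) ^ 2 ≤ ((B + 1) ^ 2 + L ^ 2) * Real.sqrt |x| := by
  have hx := abs_nonneg x
  rcases le_total |x| 1 with h | h
  · have h1 : |g x - 1| ≤ L * |x| := by simpa [h0] using hL x 0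
    have h2 : (g x - 1) ^ 2 ≤ L ^ 2 * |x| ^ 2 := by
      rw [← sq_abs, ← mul_pow]
      exact pow_le_pow_left₀ (abs_nonneg _) h1 2
    have h3 : |x| ^ 2 ≤ Real.sqrt |x| := by
      apply Real.le_sqrt_of_sq_le
      nlinarith [pow_le_one₀ hx h (n := 3)]
    nlinarith [mul_le_mul_of_nonneg_left h3 (sq_nonneg L),
      mul_nonneg (sq_nonneg (B + 1)) (Real.sqrt_nonneg |x|)]
  · have h1 : |g x - 1| ≤ B + 1 := by
      have := abs_le.1 (hB x)
      rw [abs_le]; constructor <;> linarith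
    have h2 : (g x - 1) ^ 2 ≤ (B + 1) ^ 2 := by
      rw [← sq_abs]
      exact pow_le_pow_left₀ (abs_nonneg _) h1 2
    have h3 : 1 ≤ Real.sqrt |x| := Real.one_le_sqrt.2 h
    nlinarith [mul_le_mul_of_nonneg_left h3 (sq_nonneg (B + 1)),
      mul_nonneg (sq_nonneg L) (Real.sqrt_nonneg |x|)]

lemma inner_bound (M : ℝ) (W : ℝ → ℝ)
    (hM : ∀ z : ℤ, ∫⁻ p in Set.Ioc (z : ℝ) (z + 1), ENNReal.ofReal (W p) ≤ ENNReal.ofReal M)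
    (p : ℝ) :
    ∫⁻ q, ENNReal.ofReal (Real.sqrt (1 + |p + q|) / (1 + (p + q) ^ 2 / 2)) * ENNReal.ofReal (W q)
      ≤ ENNReal.ofReal (16 * ∑' n, majA n) * ENNReal.ofReal M := by
  rw [← setLIntegral_univ, ← iUnion_Ioc_intCast,
    lintegral_iUnion (fun _ => measurableSet_Ioc) (Set.pairwise_disjoint_Ioc_intCast ℝ)]
  calc _ ≤ ∑' z : ℤ, ENNReal.ofReal (16 * majA (⌊p⌋ + z)) * ENNReal.ofReal M := by
        apply ENNReal.tsum_le_tsum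
        intro z
        calc _ ≤ ∫⁻ q in Set.Ioc (z : ℝ) (z + 1),
                ENNReal.ofReal (16 * majA (⌊p⌋ + z)) * ENNReal.ofReal (W q) := by
              apply setLIntegral_mono' measurableSet_Ioc
              intro q hq
              gcongr
              apply weight_bound
              · push_cast; linarith [Int.floor_le p, hq.1]
              · push_cast; linarith [Int.lt_floor_add_one p, hq.2]
          _ = ENNReal.ofReal (16 * majA (⌊p⌋ + z)) *
                ∫⁻ q in Set.Ioc (z : ℝ) (z + 1), ENNReal.ofReal (W q) :=
              lintegral_const_mul' _ _ ENNReal.ofReal_ne_top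
          _ ≤ _ := by gcongr; exact hM z
    _ = (∑' z : ℤ, ENNReal.ofReal (16 * majA (⌊p⌋ + z))) * ENNReal.ofReal M :=
        ENNReal.tsum_mul_right
    _ = (∑' z : ℤ, ENNReal.ofReal (16 * majA z)) * ENNReal.ofReal M := by
        rw [← (Equiv.addLeft ⌊p⌋).tsum_eq (fun z : ℤ => ENNReal.ofReal (16 * majA z))]
        rfl
    _ = _ := by
        rw [← ENNReal.ofReal_tsum_of_nonneg (fun n => mul_nonneg (by norm_num) (majA_nonneg n))
          (majA_summable.mul_left 16), tsum_mul_left]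

lemma pointwise_bound (K N p q w v h γ : ℝ) (hN : 1 ≤ N) (hK : 0 ≤ K) (hw : 0 ≤ w) (hv : 0 ≤ v)
    (hh : 0 ≤ h) (hγ : γ ≤ K * Real.sqrt |q / N|) :
    w * v * h * γ / (1 + (p + q) ^ 2 / 2) ≤
      (K * N ^ (-(1 / 2 : ℝ)) * (w * h * (1 + |p|) ^ 3)) *
        (Real.sqrt (1 + |p + q|) / (1 + (p + q) ^ 2 / 2) * v) := by
  have hN0 : 0 < N := by linarith
  have hp := abs_nonneg p
  have hs := abs_nonneg (p + q)
  have e1 : Real.sqrt |q / N| = Real.sqrt |q| * N ^ (-(1 / 2 : ℝ)) := by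
    rw [abs_div, abs_of_pos hN0, Real.sqrt_div (abs_nonneg q), Real.rpow_neg hN0.le,
      ← Real.sqrt_eq_rpow]
    rfl
  have e2 : Real.sqrt |q| ≤ (1 + |p|) ^ 3 * Real.sqrt (1 + |p + q|) := by
    have hq : |q| ≤ |p + q| + |p| := by
      have := abs_sub (p + q) p
      simpa using this
    have h1 : (1 : ℝ) ≤ (1 + |p|) := by linarith
    calc Real.sqrt |q| ≤ Real.sqrt ((1 + |p|) ^ 2 * (1 + |p + q|)) := by
          apply Real.sqrt_le_sqrt
          nlinarith [mul_nonneg hp hs, mul_nonneg hs (sq_nonneg |p|), sq_nonneg |p|]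
      _ = (1 + |p|) * Real.sqrt (1 + |p + q|) := by
          rw [Real.sqrt_mul (by positivity), Real.sqrt_sq (by positivity)]
      _ ≤ _ := by
          gcongr
          exact le_self_pow₀ h1 (by norm_num)
  have hr : 0 ≤ N ^ (-(1 / 2 : ℝ)) := by positivity
  calc w * v * h * γ / (1 + (p + q) ^ 2 / 2)
      ≤ w * v * h * (K * (((1 + |p|) ^ 3 * Real.sqrt (1 + |p + q|)) * N ^ (-(1 / 2 : ℝ)))) /
          (1 + (p + q) ^ 2 / 2) := by
        rw [e1] at hγ
        gcongr
        exact hγ.trans (by gcongr)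
    _ = _ := by ring

/-- Quantitative estimate `‖A₊ℓ_φ − g₂^N‖²_{H^{-1}_0} ≲ N^{-1/2}` from the proof of
Theorem 6.1: there is a constant `C` depending only on `M, I, B, L` such that for all
`W, H, g` with uniform local-integrability constant `M`, weighted mass `I`, bound `B`
and Lipschitz constant `L`, and all `N ≥ 1`,
`∫∫ W(p)W(q) H(p) (g(q/N)−1)² / (1+(p+q)²/2) dp dq ≤ C N^{−1/2}`. -/
theorem stmt_16 (M I B L : ℝ) :
    ∃ C : ℝ, 0 < C ∧
      ∀ (W : ℝ → ℝ), Measurable W → (∀ p, 0 ≤ W p) →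
        (∀ z : ℤ, ∫⁻ p in Set.Ioc (z : ℝ) (z + 1), ENNReal.ofReal (W p) ≤ ENNReal.ofReal M) →
      ∀ (H : ℝ → ℝ), Measurable H → (∀ p, 0 ≤ H p) →
        (∫⁻ p, ENNReal.ofReal (W p * H p * (1 + |p|) ^ 3) ≤ ENNReal.ofReal I) →
      ∀ (g : ℝ → ℝ), g 0 = 1 → (∀ x, |g x| ≤ B) → (∀ x y, |g x - g y| ≤ L * |x - y|) →
      ∀ N : ℝ, 1 ≤ N →
        ∫⁻ p, ∫⁻ q,
            ENNReal.ofReal (W p * W q * H p * (g (q / N) - 1) ^ 2 / (1 + (p + q) ^ 2 / 2))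
          ≤ ENNReal.ofReal (C * N ^ (-(1 / 2 : ℝ))) := by
  have hS : 0 ≤ ∑' n, majA n := tsum_nonneg majA_nonneg
  set S := ∑' n, majA n with hSdef
  set K := (B + 1) ^ 2 + L ^ 2 with hKdef
  have hK : 0 ≤ K := by positivity
  refine ⟨K * (max I 0) * (16 * S * max M 0) + 1, by positivity, ?_⟩
  intro W _ hW hM H _ hH hI g g0 gB gL N hN
  have hr : 0 ≤ N ^ (-(1 / 2 : ℝ)) := Real.rpow_nonneg (by linarith) _
  set r := N ^ (-(1 / 2 : ℝ)) with hrdef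
  have inner : ∀ p, ∫⁻ q,
      ENNReal.ofReal (W p * W q * H p * (g (q / N) - 1) ^ 2 / (1 + (p + q) ^ 2 / 2)) ≤
      (ENNReal.ofReal (K * r) * (ENNReal.ofReal (16 * S) * ENNReal.ofReal M)) *
        ENNReal.ofReal (W p * H p * (1 + |p|) ^ 3) := by
    intro p
    have hnn : 0 ≤ W p * H p * (1 + |p|) ^ 3 :=
      mul_nonneg (mul_nonneg (hW p) (hH p)) (by positivity)
    calc _ ≤ ∫⁻ q, ENNReal.ofReal (K * r * (W p * H p * (1 + |p|) ^ 3)) *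
            (ENNReal.ofReal (Real.sqrt (1 + |p + q|) / (1 + (p + q) ^ 2 / 2)) *
              ENNReal.ofReal (W q)) := by
          apply lintegral_mono
          intro q
          dsimp only
          rw [← ENNReal.ofReal_mul (by positivity), ← ENNReal.ofReal_mul (by positivity)]
          exact ENNReal.ofReal_le_ofReal (pointwise_bound K N p q (W p) (W q) (H p) _ hN hK
            (hW p) (hW q) (hH p) (g_bound B L g g0 gB gL (q / N)))
      _ = ENNReal.ofReal (K * r * (W p * H p * (1 + |p|) ^ 3)) * _ :=
          lintegral_const_mul' _ _ ENNReal.ofReal_ne_top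
      _ ≤ ENNReal.ofReal (K * r * (W p * H p * (1 + |p|) ^ 3)) *
            (ENNReal.ofReal (16 * S) * ENNReal.ofReal M) := by
          gcongr
          exact inner_bound M W hM p
      _ = _ := by
          rw [ENNReal.ofReal_mul (by positivity)]
          ring
  calc _ ≤ ∫⁻ p, (ENNReal.ofReal (K * r) * (ENNReal.ofReal (16 * S) * ENNReal.ofReal M)) *
        ENNReal.ofReal (W p * H p * (1 + |p|) ^ 3) := lintegral_mono inner
    _ = (ENNReal.ofReal (K * r) * (ENNReal.ofReal (16 * S) * ENNReal.ofReal M)) * _ :=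
        lintegral_const_mul' _ _ (ENNReal.mul_ne_top ENNReal.ofReal_ne_top
          (ENNReal.mul_ne_top ENNReal.ofReal_ne_top ENNReal.ofReal_ne_top))
    _ ≤ (ENNReal.ofReal (K * r) * (ENNReal.ofReal (16 * S) * ENNReal.ofReal (max M 0))) *
        ENNReal.ofReal (max I 0) := by
        gcongr
        · exact le_max_left _ _
        · exact hI.trans (ENNReal.ofReal_le_ofReal (le_max_left _ _))
    _ = ENNReal.ofReal (K * r * (16 * S * max M 0) * max I 0) := by
        rw [← ENNReal.ofReal_mul (by positivity), ← ENNReal.ofReal_mul (by positivity),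
          ← ENNReal.ofReal_mul (by positivity)]
    _ ≤ _ := by
        apply ENNReal.ofReal_le_ofReal
        nlinarith
end

section
/- There exists an absolute constant C > 0 such that for every measurable W : ℝ → [0,∞) with M := sup_{z ∈ ℤ} ∫_z^{z+1} W(p) dp < ∞, every measurable h : ℝ → ℂ, and every m ≥ 1, ∫∫_{{(p,q) ∈ ℝ² : (p+q)²/2 ≥ m}} W(p) W(q) |h(p)|² / (1 + (p+q)²/2) dp dq ≤ C · M · m^{−1/2} · ∫_ℝ W(p) |h(p)|² dp, the inequality holding in [0,∞]. -/
open MeasureTheory ENNReal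

lemma aux_Icc (F : ℝ → ℝ≥0∞) (N : ℝ≥0∞)
    (hF : ∀ z : ℤ, ∫⁻ p in Set.Ioc (z : ℝ) (z + 1), F p ≤ N) (a b : ℝ) (hb : b = a + 1) :
    ∫⁻ q in Set.Icc a b, F q ≤ 2 * N := by
  have h1 : Set.Icc a b ⊆ Set.Ioc ((⌈a⌉ - 1 : ℤ) : ℝ) ((⌈a⌉ - 1 : ℤ) + 1) ∪
      Set.Ioc ((⌈a⌉ : ℤ) : ℝ) ((⌈a⌉ : ℤ) + 1) := by
    intro x hx
    have h2 := Int.ceil_lt_add_one a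
    have h3 := Int.le_ceil a
    obtain ⟨h4, h5⟩ := hx
    push_cast
    rcases le_or_gt x ⌈a⌉ with h | h
    · left; constructor <;> linarith
    · right; constructor <;> linarith
  calc ∫⁻ q in Set.Icc a b, F q ≤ _ := lintegral_mono_set h1
    _ ≤ _ := lintegral_union_le _ _ _
    _ ≤ N + N := add_le_add (hF _) (hF _)
    _ = 2 * N := (two_mul N).symm

lemma aux_piece (W : ℝ → ℝ) (hW : Measurable W) (hW0 : ∀ p, 0 ≤ W p) (N : ℝ≥0∞)
    (hF : ∀ z : ℤ, ∫⁻ p in Set.Ioc (z : ℝ) (z + 1), ENNReal.ofReal (W p) ≤ N)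
    (p t : ℝ) (ht : 1 ≤ t) (a b : ℝ) (hb : b = a + 1)
    (hab : ∀ q ∈ Set.Icc a b, t ≤ |p + q|) :
    ∫⁻ q in Set.Icc a b, ENNReal.ofReal (W q / (1 + (p + q) ^ 2 / 2)) ≤
      ENNReal.ofReal (4 * (1 / t - 1 / (t + 1))) * (2 * N) := by
  calc ∫⁻ q in Set.Icc a b, ENNReal.ofReal (W q / (1 + (p + q) ^ 2 / 2))
      ≤ ∫⁻ q in Set.Icc a b, ENNReal.ofReal (4 * (1 / t - 1 / (t + 1))) * ENNReal.ofReal (W q) := by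
        refine setLIntegral_mono' measurableSet_Icc fun q hq => ?_
        have h1 := hab q hq
        have h0 : 0 ≤ 4 * (1 / t - 1 / (t + 1)) := by
          have : 1 / (t + 1) ≤ 1 / t := one_div_le_one_div_of_le (by linarith) (by linarith)
          linarith
        rw [← ENNReal.ofReal_mul h0]
        apply ENNReal.ofReal_le_ofReal
        rw [div_eq_inv_mul]
        refine mul_le_mul_of_nonneg_right ?_ (hW0 q)
        have h2 : t ^ 2 ≤ (p + q) ^ 2 := by
          rw [← sq_abs (p + q)]; gcongr
        have h3 : 4 * (1 / t - 1 / (t + 1)) = (t * (t + 1) / 4)⁻¹ := by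
          have : t ≠ 0 := by linarith
          have : t + 1 ≠ 0 := by linarith
          field_simp
          ring
        rw [h3]
        apply inv_anti₀ <;> nlinarith
    _ = ENNReal.ofReal (4 * (1 / t - 1 / (t + 1))) * ∫⁻ q in Set.Icc a b, ENNReal.ofReal (W q) :=
        lintegral_const_mul _ hW.ennreal_ofReal
    _ ≤ _ := by gcongr; exact aux_Icc _ N hF a b hb

lemma aux_tsum (s : ℝ) (hs : 1 ≤ s) :
    ∑' k : ℕ, ENNReal.ofReal (4 * (1 / (s + k) - 1 / (s + k + 1))) ≤ ENNReal.ofReal (4 / s) := by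
  refine ENNReal.tsum_le_of_sum_range_le fun n => ?_
  have hk : ∀ k : ℕ, (0 : ℝ) ≤ k := fun k => Nat.cast_nonneg k
  rw [← ENNReal.ofReal_sum_of_nonneg]
  · apply ENNReal.ofReal_le_ofReal
    have := Finset.sum_range_sub' (fun k : ℕ => 1 / (s + (k : ℝ))) n
    push_cast at this
    simp only [← add_assoc] at this
    rw [← Finset.mul_sum, this]
    have h2 : 0 ≤ 1 / (s + (n : ℝ)) := by have := hk n; positivity
    have : 4 / s = 4 * (1 / s) := by ring
    rw [this, add_zero]
    linarith
  · intro k _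
    have h1 := hk k
    have : 1 / (s + k + 1) ≤ 1 / (s + k) := one_div_le_one_div_of_le (by linarith) (by linarith)
    linarith

lemma aux_inner (W : ℝ → ℝ) (hW : Measurable W) (hW0 : ∀ p, 0 ≤ W p) (N : ℝ≥0∞)
    (hF : ∀ z : ℤ, ∫⁻ p in Set.Ioc (z : ℝ) (z + 1), ENNReal.ofReal (W p) ≤ N)
    (p m s : ℝ) (hs : 1 ≤ s) (hm : s ^ 2 = m) :
    ∫⁻ q in {q : ℝ | m ≤ (p + q) ^ 2 / 2}, ENNReal.ofReal (W q / (1 + (p + q) ^ 2 / 2)) ≤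
      ENNReal.ofReal (16 / s) * N := by
  have hcov : {q : ℝ | m ≤ (p + q) ^ 2 / 2} ⊆ ⋃ k : ℕ,
      (Set.Icc (s + k - p) (s + k + 1 - p) ∪ Set.Icc (-(s + k + 1) - p) (-(s + k) - p)) := by
    intro q hq
    have hq' : m ≤ (p + q) ^ 2 / 2 := hq
    have h1 : s ≤ |p + q| := by
      refine le_trans (le_abs_self s) (sq_le_sq.1 ?_)
      nlinarith
    have h2 := Nat.floor_le (sub_nonneg.2 h1)
    have h3 := Nat.lt_floor_add_one (|p + q| - s)
    refine Set.mem_iUnion.2 ⟨⌊|p + q| - s⌋₊, ?_⟩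
    rcases abs_cases (p + q) with ⟨h, _⟩ | ⟨h, _⟩
    · left; constructor <;> linarith
    · right; constructor <;> linarith
  have hk : ∀ k : ℕ, (0 : ℝ) ≤ k := fun k => Nat.cast_nonneg k
  calc _ ≤ _ := lintegral_mono_set hcov
    _ ≤ _ := lintegral_iUnion_le _ _
    _ ≤ ∑' k : ℕ, ENNReal.ofReal (4 * (1 / (s + k) - 1 / (s + k + 1))) * (4 * N) := by
        refine ENNReal.tsum_le_tsum fun k => ?_
        have h0 := hk k
        refine (lintegral_union_le _ _ _).trans ?_
        refine (add_le_add
          (aux_piece W hW hW0 N hF p (s + k) (by linarith) _ _ (by ring) ?_)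
          (aux_piece W hW hW0 N hF p (s + k) (by linarith) _ _ (by ring) ?_)).trans ?_
        · rintro q ⟨h1, h2⟩
          exact le_trans (by linarith) (le_abs_self _)
        · rintro q ⟨h1, h2⟩
          exact le_trans (by linarith) (neg_le_abs _)
        · apply le_of_eq; ring
    _ = (∑' k : ℕ, ENNReal.ofReal (4 * (1 / (s + k) - 1 / (s + k + 1)))) * (4 * N) :=
        ENNReal.tsum_mul_right
    _ ≤ ENNReal.ofReal (4 / s) * (4 * N) := by gcongr; exact aux_tsum s hs
    _ = ENNReal.ofReal (16 / s) * N := by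
        rw [← mul_assoc]
        congr 1
        have : (4 : ℝ≥0∞) = ENNReal.ofReal 4 := by simp
        rw [this, ← ENNReal.ofReal_mul (by positivity)]
        congr 1; ring

/-- Spectral-truncation tail estimate (used in Theorem 4.3 and Lemma 3.14): there is an
absolute constant `C` such that for every `W` with uniform local-integrability constant
`M`, every measurable `h` and every `m ≥ 1`,
`∫∫_{(p+q)²/2 ≥ m} W(p)W(q)|h(p)|²/(1+(p+q)²/2) dp dq ≤ C M m^{−1/2} ∫ W(p)|h(p)|² dp`. -/
theorem stmt_18 :
    ∃ C : ℝ, 0 < C ∧ ∀ (W : ℝ → ℝ), Measurable W → (∀ p, 0 ≤ W p) →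
      ∀ M : ℝ,
        (∀ z : ℤ, ∫⁻ p in Set.Ioc (z : ℝ) (z + 1), ENNReal.ofReal (W p) ≤ ENNReal.ofReal M) →
      ∀ h : ℝ → ℂ, Measurable h → ∀ m : ℝ, 1 ≤ m →
        ∫⁻ p, ∫⁻ q in {q : ℝ | m ≤ (p + q) ^ 2 / 2},
            ENNReal.ofReal (W p * W q * ‖h p‖ ^ 2 / (1 + (p + q) ^ 2 / 2))
          ≤ ENNReal.ofReal (C * M * m ^ (-(1 / 2 : ℝ))) *
              ∫⁻ p, ENNReal.ofReal (W p * ‖h p‖ ^ 2) := by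
  refine ⟨16, by norm_num, ?_⟩
  intro W hW hW0 M hM h hh m hm
  have hs : 1 ≤ √m := Real.one_le_sqrt.2 hm
  have hsm : √m ^ 2 = m := Real.sq_sqrt (by linarith)
  have hC : ENNReal.ofReal (16 * M * m ^ (-(1 / 2 : ℝ))) =
      ENNReal.ofReal (16 / √m) * ENNReal.ofReal M := by
    rw [← ENNReal.ofReal_mul (by positivity), Real.rpow_neg (by linarith), ← Real.sqrt_eq_rpow]
    congr 1; ring
  rw [hC, ← lintegral_const_mul _ (by fun_prop)]
  refine lintegral_mono fun p => ?_
  have hp : 0 ≤ W p * ‖h p‖ ^ 2 := mul_nonneg (hW0 p) (by positivity)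
  calc ∫⁻ q in {q : ℝ | m ≤ (p + q) ^ 2 / 2},
            ENNReal.ofReal (W p * W q * ‖h p‖ ^ 2 / (1 + (p + q) ^ 2 / 2))
      = ∫⁻ q in {q : ℝ | m ≤ (p + q) ^ 2 / 2}, ENNReal.ofReal (W p * ‖h p‖ ^ 2) *
            ENNReal.ofReal (W q / (1 + (p + q) ^ 2 / 2)) := by
        congr 1; funext q
        rw [← ENNReal.ofReal_mul hp]
        congr 1; ring
    _ = ENNReal.ofReal (W p * ‖h p‖ ^ 2) * ∫⁻ q in {q : ℝ | m ≤ (p + q) ^ 2 / 2},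
            ENNReal.ofReal (W q / (1 + (p + q) ^ 2 / 2)) :=
        lintegral_const_mul _ (by fun_prop)
    _ ≤ ENNReal.ofReal (W p * ‖h p‖ ^ 2) * (ENNReal.ofReal (16 / √m) * ENNReal.ofReal M) := by
        gcongr; exact aux_inner W hW hW0 _ hM p m _ hs hsm
    _ = _ := mul_comm _ _
end
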